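/- arXiv:dg-ga/9604003 — 2 statements merged into one kernel-verified Lean document; each statement's English description precedes it below -/
import Mathlib

section
/- Let f be a profile function and let 1 ≤ k < l be integers. If λ is the least eigenvalue of L_k (i.e., IsLeast (Spec L_k) λ) and μ is the least eigenvalue of L_l (i.e., IsLeast (Spec L_l) μ), then λ < μ. -/
open Set MeasureTheory intervalIntegral Filter

/-- A profile function for a surface of revolution diffeomorphic to `S²` of area `4π`:
continuous on `[-1,1]`, smooth and positive on `(-1,1)`, vanishing at `±1`,
with derivative `2` at `-1` and `-2` at `1`. -/
structure IsProfile (f : ℝ → ℝ) : Prop where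
  contOn : ContinuousOn f (Icc (-1) 1)
  smoothOn : ContDiffOn ℝ (⊤ : ℕ∞) f (Ioo (-1) 1)
  pos : ∀ x ∈ Ioo (-1:ℝ) 1, 0 < f x
  zero_neg_one : f (-1) = 0
  zero_one : f 1 = 0
  deriv_neg_one : HasDerivAt f 2 (-1)
  deriv_one : HasDerivAt f (-2) 1

/-- `λ` is an eigenvalue of the Sturm–Liouville operator
`L_k = -(d/dx)(f(x) d/dx) + k²/f(x)` on `(-1,1)`, with Dirichlet boundary
conditions at `±1` when `k ≥ 1`. -/
def InSpec (f : ℝ → ℝ) (k : ℕ) (lam : ℝ) : Prop :=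
  ∃ u : ℝ → ℝ, ContinuousOn u (Icc (-1) 1) ∧ ContDiffOn ℝ (⊤ : ℕ∞) u (Ioo (-1) 1) ∧
    (∃ x ∈ Ioo (-1:ℝ) 1, u x ≠ 0) ∧
    (1 ≤ k → u (-1) = 0 ∧ u 1 = 0) ∧
    ∀ x ∈ Ioo (-1:ℝ) 1,
      -(deriv (fun y => f y * deriv u y) x) + ((k:ℝ)^2 / f x) * u x = lam * u x

/-- The spectrum of `L_k`. -/
def Spec (f : ℝ → ℝ) (k : ℕ) : Set ℝ := {lam | InSpec f k lam}

/-- The set of distinct eigenvalues of the Laplacian of the surface of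
revolution determined by `f`. -/
def Eigs (f : ℝ → ℝ) : Set ℝ := ⋃ k : ℕ, Spec f k

/-- A compact symmetric operator whose quadratic form exceeds `c` somewhere on the unit sphere has
an eigenvalue larger than `c`. -/
theorem ContinuousLinearMap.exists_hasEigenvalue_gt_of_lt_inner {E : Type*} [NormedAddCommGroup E]
    [InnerProductSpace ℝ E] [CompleteSpace E] {T : E →L[ℝ] E} (hT : IsCompactOperator T)
    (hs : T.IsSymmetric) {c : ℝ} (hc : 0 ≤ c) {v : E} (hv : c * ‖v‖ ^ 2 < inner ℝ (T v) v) :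
    ∃ r > c, Module.End.HasEigenvalue (T : Module.End ℝ E) r := by
  have hv0 : v ≠ 0 := by rintro rfl; simp at hv
  have : Nontrivial E := ⟨⟨v, 0, hv0⟩⟩
  set S : E →L[ℝ] E := T + algebraMap ℝ (E →L[ℝ] E) ‖T‖ with hS
  have hSsymm : S.IsSymmetric := by
    intro x y
    have := hs x y
    simp only [ContinuousLinearMap.coe_coe] at this ⊢
    simp [hS, inner_add_left, inner_add_right, this, ContinuousLinearMap.algebraMap_apply,
      inner_smul_left, inner_smul_right]
  have hR (x : E) (hx : x ≠ 0) : S.rayleighQuotient x = T.rayleighQuotient x + ‖T‖ := by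
    have : ‖x‖ ≠ 0 := by simpa
    simp only [ContinuousLinearMap.rayleighQuotient, ContinuousLinearMap.reApplyInnerSelf_apply, hS]
    simp [inner_add_left, ContinuousLinearMap.algebraMap_apply, inner_smul_left]
    field_simp
  have hR0 (x : E) : 0 ≤ S.rayleighQuotient x := by
    by_cases hx : x = 0
    · simp [hx]
    · rw [hR x hx]
      linarith [neg_le_of_abs_le (T.rayleighQuotient_le_norm x)]
  have hspec : ‖S‖ ∈ spectrum ℝ S := by
    by_contra h
    obtain ⟨ε, hε, hle⟩ := S.rayleighQuotient_le_of_norm_mem_resolventSet (𝕜 := ℝ)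
      (by simpa [spectrum] using h)
    have := S.norm_eq_iSup_rayleighQuotient hSsymm
    have h2 : (⨆ x, |S.rayleighQuotient x|) ≤ ‖S‖ - ε :=
      ciSup_le fun x => by rw [abs_of_nonneg (hR0 x)]; exact hle x
    linarith
  have hlt : c < ‖S‖ - ‖T‖ := by
    have h1 := (abs_le.1 (S.rayleighQuotient_le_norm v)).2
    rw [hR v hv0] at h1
    have h2 : c < T.rayleighQuotient v := by
      have : 0 < ‖v‖ := by simpa
      simp only [ContinuousLinearMap.rayleighQuotient, ContinuousLinearMap.reApplyInnerSelf_apply]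
      rw [lt_div_iff₀ (by positivity)]
      simpa using hv
    linarith
  refine ⟨‖S‖ - ‖T‖, hlt, ?_⟩
  rw [hT.hasEigenvalue_iff_mem_spectrum (by linarith)]
  rw [spectrum.mem_iff] at hspec ⊢
  convert hspec using 2
  rw [hS, map_sub]; abel

/-- An operator into `C(X, ℝ)` represented by a continuous Hilbert space valued kernel is
compact. -/
theorem isCompactOperator_of_forall_apply_eq_inner {X E : Type*} [TopologicalSpace X]
    [CompactSpace X] [NormedAddCommGroup E] [InnerProductSpace ℝ E] {g : X → E} (hg : Continuous g)
    (A : E →L[ℝ] C(X, ℝ)) (hA : ∀ u x, A u x = inner ℝ (g x) u) : IsCompactOperator A := by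
  refine (isCompactOperator_iff_isCompact_closure_image_closedBall
    (A : E →ₗ[ℝ] C(X, ℝ)) one_pos).2 ?_
  simp only [ContinuousLinearMap.coe_coe]
  let e := ContinuousMap.isometryEquivBoundedOfCompact X ℝ
  have key : IsCompact (closure (e '' (A '' Metric.closedBall 0 1))) := by
    refine BoundedContinuousFunction.arzela_ascoli (Metric.closedBall 0 ‖A‖)
      (isCompact_closedBall _ _) _ ?_ ?_
    · rintro _ x ⟨_, ⟨u, hu, rfl⟩, rfl⟩
      rw [mem_closedBall_zero_iff] at hu ⊢
      calc ‖A u x‖ ≤ ‖A u‖ := ContinuousMap.norm_coe_le_norm _ _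
        _ ≤ ‖A‖ := A.unit_le_opNorm u hu
    · intro x
      rw [Metric.equicontinuousAt_iff_right]
      intro ε hε
      filter_upwards [Metric.continuousAt_iff'.1 hg.continuousAt ε hε] with y hy
      rintro ⟨_, _, ⟨u, hu, rfl⟩, rfl⟩
      rw [mem_closedBall_zero_iff] at hu
      change dist (A u x) (A u y) < ε
      rw [hA, hA, dist_comm, Real.dist_eq, ← inner_sub_left]
      calc |inner ℝ (g y - g x) u| ≤ ‖g y - g x‖ * ‖u‖ := abs_real_inner_le_norm _ _
        _ ≤ ‖g y - g x‖ := mul_le_of_le_one_right (norm_nonneg _) hu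
        _ < ε := by rwa [← dist_eq_norm]
  have h := e.toHomeomorph.image_closure (A '' Metric.closedBall 0 1)
  simp only [IsometryEquiv.coe_toHomeomorph] at h
  rw [← h] at key
  exact e.toHomeomorph.isCompact_image.1 key

/-- Variational principle for an integral operator with a bounded, symmetric, separately
continuous kernel: if its quadratic form exceeds `c` somewhere on the unit sphere of `L²`, then it
has a continuous eigenfunction with eigenvalue larger than `c`. -/
theorem exists_continuous_eigenfunction_of_lt_integral {X : Type*} [MetricSpace X] [CompactSpace X]
    [MeasurableSpace X] [BorelSpace X] (μ : Measure X) [IsFiniteMeasure μ]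
    {G : X → X → ℝ} (hG : ∀ s, Continuous fun x => G x s) (hsymm : ∀ x s, G x s = G s x)
    {C : ℝ} (hC : ∀ x s, |G x s| ≤ C) {c : ℝ} (hc : 0 ≤ c) (v : C(X, ℝ))
    (hv : c * ∫ x, v x ^ 2 ∂μ < ∫ x, (∫ s, G x s * v s ∂μ) * v x ∂μ) :
    ∃ r > c, ∃ w : C(X, ℝ), w ≠ 0 ∧ ∀ x, ∫ s, G x s * w s ∂μ = r * w x := by
  let J : C(X, ℝ) →L[ℝ] Lp ℝ 2 μ := ContinuousMap.toLp 2 μ ℝ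
  have hJ (a b : C(X, ℝ)) : inner ℝ (J a) (J b) = ∫ x, a x * b x ∂μ := by
    simp only [J, ContinuousMap.inner_toLp]
    simp [mul_comm]
  let k (x : X) : C(X, ℝ) := ⟨fun s => G x s, by simpa only [hsymm x] using hG x⟩
  let g (x : X) : Lp ℝ 2 μ := J (k x)
  have hg : Continuous g := by
    rw [continuous_iff_continuousAt]
    intro x
    rw [ContinuousAt, tendsto_iff_norm_sub_tendsto_zero]
    have h1 : Tendsto (fun y => ∫ s, (G y s - G x s) * (G y s - G x s) ∂μ) (nhds x) (nhds 0) := by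
      have : Continuous fun y => ∫ s, (G y s - G x s) * (G y s - G x s) ∂μ := by
        refine continuous_of_dominated (bound := fun _ => (C + C) * (C + C)) ?_ ?_
          (integrable_const _) ?_
        · intro y
          exact (((k y).continuous.sub (k x).continuous).mul
            ((k y).continuous.sub (k x).continuous)).aestronglyMeasurable
        · intro y
          refine Eventually.of_forall fun s => ?_
          have h := (abs_sub (G y s) (G x s)).trans (add_le_add (hC y s) (hC x s))
          rw [norm_mul, Real.norm_eq_abs]
          gcongr
          exact (abs_nonneg _).trans h
        · exact Eventually.of_forall fun s =>
            ((hG s).sub continuous_const).mul ((hG s).sub continuous_const)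
      simpa using this.tendsto x
    have h2 (y : X) : ‖g y - g x‖ = √(∫ s, (G y s - G x s) * (G y s - G x s) ∂μ) := by
      rw [norm_eq_sqrt_real_inner, ← map_sub, hJ]
      rfl
    simp_rw [h2]
    simpa using h1.sqrt
  obtain ⟨M, hM⟩ : ∃ M, ∀ x, ‖g x‖ ≤ M := by
    obtain ⟨M, hM⟩ := isCompact_univ.exists_bound_of_continuousOn hg.continuousOn
    exact ⟨M, fun x => hM x (mem_univ x)⟩
  let A₀ : Lp ℝ 2 μ →ₗ[ℝ] C(X, ℝ) :=
    { toFun := fun u => ⟨fun x => inner ℝ (g x) u, hg.inner continuous_const⟩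
      map_add' := fun u w => by ext x; simp [inner_add_right]
      map_smul' := fun a u => by ext x; simp [inner_smul_right] }
  let A : Lp ℝ 2 μ →L[ℝ] C(X, ℝ) := A₀.mkContinuous (max M 0) fun u => by
    rw [ContinuousMap.norm_le _ (by positivity)]
    intro x
    calc ‖inner ℝ (g x) u‖ ≤ ‖g x‖ * ‖u‖ := norm_inner_le_norm _ _
      _ ≤ max M 0 * ‖u‖ := by gcongr; exact (hM x).trans (le_max_left _ _)
  have hA (u x) : A u x = inner ℝ (g x) u := rfl
  have hAJ (w : C(X, ℝ)) (x : X) : A (J w) x = ∫ s, G x s * w s ∂μ := by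
    rw [hA, hJ]; rfl
  let T : Lp ℝ 2 μ →L[ℝ] Lp ℝ 2 μ := J ∘L A
  have hT : IsCompactOperator T :=
    (isCompactOperator_of_forall_apply_eq_inner hg A hA).clm_comp J
  have hdense : DenseRange J := ContinuousMap.toLp_denseRange ℝ μ ℝ (by simp)
  have hmeas : Measurable (Function.uncurry G) :=
    measurable_uncurry_of_continuous_of_measurable hG fun x => (k x).continuous.measurable
  have hTs : T.IsSymmetric := by
    intro x y
    simp only [ContinuousLinearMap.coe_coe]
    refine hdense.induction_on₂ (p := fun x y => inner ℝ (T x) y = inner ℝ x (T y)) ?_ ?_ x y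
    · exact isClosed_eq (by fun_prop) (by fun_prop)
    · intro a b
      simp only [T, ContinuousLinearMap.comp_apply, hJ, hAJ]
      simp_rw [← MeasureTheory.integral_mul_const, ← MeasureTheory.integral_const_mul]
      rw [integral_integral_swap]
      · refine integral_congr_ae (Eventually.of_forall fun x => ?_)
        refine integral_congr_ae (Eventually.of_forall fun s => ?_)
        simp only [hsymm x s]
        ring
      · refine Integrable.of_bound (C := C * ‖a‖ * ‖b‖) ?_ ?_
        · refine Measurable.aestronglyMeasurable ?_
          have := a.continuous.measurable
          have := b.continuous.measurable
          exact (hmeas.mul (by fun_prop)).mul (by fun_prop)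
        · refine Eventually.of_forall fun p => ?_
          simp only [Function.uncurry, norm_mul]
          have := hC p.1 p.2
          have h0 := (abs_nonneg _).trans this
          gcongr
          · exact this
          · exact a.norm_coe_le_norm _
          · exact b.norm_coe_le_norm _
  have hlt : c * ‖J v‖ ^ 2 < inner ℝ (T (J v)) (J v) := by
    rw [← real_inner_self_eq_norm_sq, hJ]
    simp only [T, ContinuousLinearMap.comp_apply, hJ, hAJ]
    simpa [sq] using hv
  obtain ⟨r, hr, he⟩ := ContinuousLinearMap.exists_hasEigenvalue_gt_of_lt_inner hT hTs hc hlt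
  obtain ⟨e, he⟩ := he.exists_hasEigenvector
  have hr0 : r ≠ 0 := (hc.trans_lt hr).ne'
  have hTe : J (A e) = r • e := he.apply_eq_smul
  have hJw : J (r⁻¹ • A e) = e := by rw [map_smul, hTe, inv_smul_smul₀ hr0]
  refine ⟨r, hr, r⁻¹ • A e, ?_, fun x => ?_⟩
  · intro h0
    rw [h0, map_zero] at hJw
    exact he.2 hJw.symm
  · rw [← hAJ, hJw]
    simp [hr0]

/-- A primitive of `1 / f` tends to infinity at `1` if `f` has a simple zero there. -/
theorem tendsto_atTop_of_hasDerivAt_inv {f P : ℝ → ℝ} (hpos : ∀ x ∈ Ioo (-1 : ℝ) 1, 0 < f x)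
    (h1 : f 1 = 0) (hd : HasDerivAt f (-2) 1)
    (hP : ∀ x ∈ Ioo (-1 : ℝ) 1, HasDerivAt P (f x)⁻¹ x) :
    Tendsto P (nhdsWithin 1 (Iio 1)) atTop := by
  have hslope : ∀ᶠ x in nhdsWithin 1 (Iio 1), f x < 3 * (1 - x) := by
    have h := (hasDerivAt_iff_tendsto_slope.1 hd).mono_left
      (nhdsWithin_mono 1 fun x (hx : x < 1) => hx.ne)
    filter_upwards [h.eventually_const_lt (show (-3 : ℝ) < -2 by norm_num), self_mem_nhdsWithin]
      with x hx hx1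
    have hx1 : x - 1 < 0 := sub_neg.2 hx1
    rw [slope_def_field, h1, lt_div_iff_of_neg hx1] at hx
    linarith
  obtain ⟨a, ha, hfa⟩ := (mem_nhdsLT_iff_exists_mem_Ico_Ioo_subset (show (0 : ℝ) < 1 by norm_num)).1
    hslope
  have hmono : MonotoneOn (fun x => P x + 1 / 3 * Real.log (1 - x)) (Ioo a 1) := by
    have hder : ∀ x ∈ Ioo a 1, HasDerivAt (fun x => P x + 1 / 3 * Real.log (1 - x))
        ((f x)⁻¹ + 1 / 3 * (-1 / (1 - x))) x := by
      intro x hx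
      have h2 : HasDerivAt (fun x : ℝ => 1 - x) (-1) x := by
        simpa using (hasDerivAt_id x).const_sub 1
      exact (hP x ⟨by linarith [ha.1, hx.1], hx.2⟩).add
        ((h2.log (by linarith [hx.2])).const_mul _)
    refine monotoneOn_of_deriv_nonneg (convex_Ioo a 1)
      (fun x hx => (hder x hx).continuousAt.continuousWithinAt) ?_ ?_
    · rw [interior_Ioo]
      exact fun x hx => (hder x hx).differentiableAt.differentiableWithinAt
    · rw [interior_Ioo]
      intro x hx
      rw [(hder x hx).deriv]
      have h3 : f x < 3 * (1 - x) := hfa hx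
      have h4 := inv_anti₀ (hpos x ⟨by linarith [ha.1, hx.1], hx.2⟩) h3.le
      have h5 : (3 * (1 - x))⁻¹ = 1 / 3 * (1 / (1 - x)) := by
        rw [mul_inv]; ring
      rw [h5] at h4
      rw [neg_div]
      linarith
  obtain ⟨b, hb⟩ : (Ioo a 1).Nonempty := nonempty_Ioo.2 ha.2
  have hlog : Tendsto (fun x : ℝ => P b + 1 / 3 * Real.log (1 - b) + 1 / 3 * -Real.log (1 - x))
      (nhdsWithin 1 (Iio 1)) atTop := by
    have h6 : Tendsto (fun x : ℝ => 1 - x) (nhdsWithin 1 (Iio 1)) (nhdsWithin 0 (Ioi 0)) := by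
      refine tendsto_nhdsWithin_iff.2 ⟨?_, ?_⟩
      · have : Continuous fun x : ℝ => 1 - x := by fun_prop
        simpa using (this.tendsto 1).mono_left nhdsWithin_le_nhds
      · filter_upwards [self_mem_nhdsWithin] with x hx
        exact sub_pos.2 (mem_Iio.1 hx)
    refine tendsto_atTop_add_const_left _ _ (Tendsto.const_mul_atTop (by norm_num) ?_)
    exact tendsto_neg_atBot_atTop.comp (Real.tendsto_log_nhdsGT_zero.comp h6)
  refine tendsto_atTop_mono' _ ?_ hlog
  filter_upwards [Ioo_mem_nhdsLT hb.2] with x hx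
  have := hmono hb ⟨hb.1.trans hx.1, hx.2⟩ hx.1.le
  simp only at this
  linarith

theorem IsProfile.exists_primitive_inv {f : ℝ → ℝ} (hf : IsProfile f) :
    ∃ P : ℝ → ℝ, (∀ x ∈ Ioo (-1 : ℝ) 1, HasDerivAt P (f x)⁻¹ x) ∧
      Tendsto P (nhdsWithin 1 (Iio 1)) atTop ∧ Tendsto P (nhdsWithin (-1) (Ioi (-1))) atBot := by
  have hcont : ContinuousOn (fun x => (f x)⁻¹) (Ioo (-1) 1) :=
    (hf.contOn.mono Ioo_subset_Icc_self).inv₀ fun x hx => (hf.pos x hx).ne'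
  have hP : ∀ x ∈ Ioo (-1 : ℝ) 1,
      HasDerivAt (fun x => ∫ t in (0 : ℝ)..x, (f t)⁻¹) (f x)⁻¹ x := by
    intro x hx
    refine intervalIntegral.integral_hasDerivAt_right ?_ ?_
      (hcont.continuousAt (isOpen_Ioo.mem_nhds hx))
    · refine (hcont.mono ?_).intervalIntegrable
      exact (convex_Ioo _ _).ordConnected.uIcc_subset (by norm_num) hx
    · exact hcont.stronglyMeasurableAtFilter isOpen_Ioo x hx
  refine ⟨_, hP, tendsto_atTop_of_hasDerivAt_inv hf.pos hf.zero_one hf.deriv_one hP, ?_⟩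
  set P := fun x => ∫ t in (0 : ℝ)..x, (f t)⁻¹
  have hmem : ∀ x ∈ Ioo (-1 : ℝ) 1, -x ∈ Ioo (-1 : ℝ) 1 := fun x hx =>
    ⟨by linarith [hx.2], by linarith [hx.1]⟩
  have hrefl : Tendsto (fun x => -P (-x)) (nhdsWithin 1 (Iio 1)) atTop := by
    refine tendsto_atTop_of_hasDerivAt_inv (f := fun x => f (-x)) (fun x hx => hf.pos _ (hmem x hx))
      hf.zero_neg_one ?_ ?_
    · exact (hf.deriv_neg_one.scomp (1 : ℝ) (hasDerivAt_neg 1)).congr_deriv (by simp)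
    · intro x hx
      exact ((hP _ (hmem x hx)).scomp x (hasDerivAt_neg x)).neg.congr_deriv (by simp)
  have hneg : Tendsto Neg.neg (nhdsWithin (-1 : ℝ) (Ioi (-1))) (nhdsWithin 1 (Iio 1)) := by
    simpa using tendsto_neg_nhdsGT (a := (-1 : ℝ))
  have h := tendsto_neg_atTop_atBot.comp (hrefl.comp hneg)
  simpa [Function.comp_def] using h

/-- Maximum principle: if `q > 0`, a solution of `(f w')' = q w` vanishing at `±1` is zero. -/
theorem eqOn_zero_of_sturm {f w z q : ℝ → ℝ} (hpos : ∀ x ∈ Ioo (-1 : ℝ) 1, 0 < f x)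
    (hq : ∀ x ∈ Ioo (-1 : ℝ) 1, 0 < q x) (hw : ContinuousOn w (Icc (-1) 1))
    (hw₀ : w (-1) = 0) (hw₁ : w 1 = 0) (hwz : ∀ x ∈ Ioo (-1 : ℝ) 1, HasDerivAt w (z x / f x) x)
    (hz : ∀ x ∈ Ioo (-1 : ℝ) 1, HasDerivAt z (q x * w x) x) :
    ∀ x ∈ Icc (-1 : ℝ) 1, w x = 0 := by
  have key : ∀ w z : ℝ → ℝ, ContinuousOn w (Icc (-1) 1) → w (-1) = 0 → w 1 = 0 →
      (∀ x ∈ Ioo (-1 : ℝ) 1, HasDerivAt w (z x / f x) x) →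
      (∀ x ∈ Ioo (-1 : ℝ) 1, HasDerivAt z (q x * w x) x) → ∀ x ∈ Icc (-1 : ℝ) 1, w x ≤ 0 := by
    intro w z hw hw₀ hw₁ hwz hz x hx
    by_contra! hxpos
    obtain ⟨m, hm, hmax⟩ := isCompact_Icc.exists_isMaxOn ⟨x, hx⟩ hw
    have hmpos : 0 < w m := hxpos.trans_le (hmax hx)
    have hm' : m ∈ Ioo (-1 : ℝ) 1 := by
      refine ⟨lt_of_le_of_ne hm.1 ?_, lt_of_le_of_ne hm.2 ?_⟩
      · rintro rfl; exact hmpos.ne' hw₀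
      · rintro rfl; exact hmpos.ne' hw₁
    have hzm : z m = 0 := by
      have := (hmax.isLocalMax (Icc_mem_nhds hm'.1 hm'.2)).hasDerivAt_eq_zero (hwz m hm')
      simpa [(hpos m hm').ne'] using this
    have hzpos : ∀ᶠ y in nhdsWithin m (Ioi m), 0 < z y := by
      have h := (hasDerivAt_iff_tendsto_slope.1 (hz m hm')).mono_left
        (nhdsWithin_mono m fun y (hy : m < y) => hy.ne')
      filter_upwards [h.eventually_const_lt (mul_pos (hq m hm') hmpos), self_mem_nhdsWithin]
        with y hy hy1
      rw [slope_def_field, hzm, sub_zero] at hy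
      exact (div_pos_iff_of_pos_right (sub_pos.2 hy1)).1 hy
    obtain ⟨b, hb, hsub⟩ := (mem_nhdsGT_iff_exists_mem_Ioc_Ioo_subset hm'.2).1 hzpos
    obtain ⟨d, hd⟩ : (Ioo m b).Nonempty := nonempty_Ioo.2 hb.1
    have hIcc : Icc m d ⊆ Ioo (-1) 1 := fun y hy =>
      ⟨hm'.1.trans_le hy.1, hy.2.trans_lt (hd.2.trans_le hb.2)⟩
    have hmono : StrictMonoOn w (Icc m d) := by
      refine strictMonoOn_of_deriv_pos (convex_Icc m d)
        (hw.mono (hIcc.trans Ioo_subset_Icc_self)) fun y hy => ?_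
      rw [interior_Icc] at hy
      have hy' := hIcc (Ioo_subset_Icc_self hy)
      rw [(hwz y hy').deriv]
      exact div_pos (hsub ⟨hy.1, hy.2.trans hd.2⟩) (hpos y hy')
    exact (hmono (left_mem_Icc.2 hd.1.le) (right_mem_Icc.2 hd.1.le) hd.1).not_ge
      (hmax (Ioo_subset_Icc_self (hIcc (right_mem_Icc.2 hd.1.le))))
  intro x hx
  refine le_antisymm (key w z hw hw₀ hw₁ hwz hz x hx) ?_
  have := key (fun x => -w x) (fun x => -z x) hw.neg (by simp [hw₀]) (by simp [hw₁])
    (fun x hx => by exact (hwz x hx).neg.congr_deriv (by ring))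
    (fun x hx => by exact (hz x hx).neg.congr_deriv (by ring)) x hx
  linarith

/-- Solutions of the first order system `u' = z / f`, `z' = q u` are smooth. -/
theorem contDiffOn_of_sturm {f u z q : ℝ → ℝ} (hf : ContDiffOn ℝ (⊤ : ℕ∞) f (Ioo (-1) 1))
    (hpos : ∀ x ∈ Ioo (-1 : ℝ) 1, 0 < f x) (hq : ContDiffOn ℝ (⊤ : ℕ∞) q (Ioo (-1) 1))
    (hu : ∀ x ∈ Ioo (-1 : ℝ) 1, HasDerivAt u (z x / f x) x)
    (hz : ∀ x ∈ Ioo (-1 : ℝ) 1, HasDerivAt z (q x * u x) x) :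
    ContDiffOn ℝ (⊤ : ℕ∞) u (Ioo (-1) 1) := by
  have key : ∀ n : ℕ, ContDiffOn ℝ n u (Ioo (-1) 1) ∧ ContDiffOn ℝ n z (Ioo (-1) 1) := by
    intro n
    induction n with
    | zero =>
      simp only [Nat.cast_zero, contDiffOn_zero]
      exact ⟨fun x hx => (hu x hx).continuousAt.continuousWithinAt,
        fun x hx => (hz x hx).continuousAt.continuousWithinAt⟩
    | succ n ih =>
      have hfn : ContDiffOn ℝ n f (Ioo (-1) 1) := hf.of_le (by exact_mod_cast le_top)
      have hqn : ContDiffOn ℝ n q (Ioo (-1) 1) := hq.of_le (by exact_mod_cast le_top)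
      push_cast
      rw [contDiffOn_succ_iff_deriv_of_isOpen isOpen_Ioo,
        contDiffOn_succ_iff_deriv_of_isOpen isOpen_Ioo]
      refine ⟨⟨fun x hx => (hu x hx).differentiableAt.differentiableWithinAt, by simp, ?_⟩,
        ⟨fun x hx => (hz x hx).differentiableAt.differentiableWithinAt, by simp, ?_⟩⟩
      · exact (ih.2.div hfn fun x hx => (hpos x hx).ne').congr fun x hx => (hu x hx).deriv
      · exact (hqn.mul ih.1).congr fun x hx => (hz x hx).deriv
  exact contDiffOn_infty.2 fun n => (key n).1

/-- The Green kernel of `u ↦ -(f u')' + κ² / f u` with Dirichlet conditions at `±1`, expressed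
through a primitive `P` of `1 / f`. -/
noncomputable def greenKernel (P : ℝ → ℝ) (κ x s : ℝ) : ℝ :=
  open scoped Classical in
  if x ∈ Ioo (-1 : ℝ) 1 ∧ s ∈ Ioo (-1 : ℝ) 1 then Real.exp (-κ * |P x - P s|) / (2 * κ) else 0

theorem greenKernel_of_mem {P : ℝ → ℝ} {κ x s : ℝ} (hx : x ∈ Ioo (-1 : ℝ) 1)
    (hs : s ∈ Ioo (-1 : ℝ) 1) : greenKernel P κ x s = Real.exp (-κ * |P x - P s|) / (2 * κ) :=
  if_pos ⟨hx, hs⟩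

theorem greenKernel_comm (P : ℝ → ℝ) (κ x s : ℝ) : greenKernel P κ x s = greenKernel P κ s x := by
  simp only [greenKernel, and_comm, abs_sub_comm]

theorem greenKernel_nonneg (P : ℝ → ℝ) {κ : ℝ} (hκ : 0 < κ) (x s : ℝ) :
    0 ≤ greenKernel P κ x s := by
  unfold greenKernel
  split_ifs <;> positivity

theorem greenKernel_le (P : ℝ → ℝ) {κ : ℝ} (hκ : 0 < κ) (x s : ℝ) :
    greenKernel P κ x s ≤ 1 / (2 * κ) := by
  unfold greenKernel
  split_ifs
  · gcongr
    rw [Real.exp_le_one_iff, neg_mul, neg_nonpos]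
    positivity
  · positivity

theorem abs_greenKernel_le (P : ℝ → ℝ) {κ : ℝ} (hκ : 0 < κ) (x s : ℝ) :
    |greenKernel P κ x s| ≤ 1 / (2 * κ) := by
  rw [abs_of_nonneg (greenKernel_nonneg P hκ x s)]
  exact greenKernel_le P hκ x s

theorem greenKernel_lt_greenKernel (P : ℝ → ℝ) {κ κ' : ℝ} (hκ : 0 < κ) (h : κ < κ') {x s : ℝ}
    (hx : x ∈ Ioo (-1 : ℝ) 1) (hs : s ∈ Ioo (-1 : ℝ) 1) :
    greenKernel P κ' x s < greenKernel P κ x s := by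
  rw [greenKernel_of_mem hx hs, greenKernel_of_mem hx hs]
  refine div_lt_div₀' (Real.exp_le_exp.2 ?_) (by linarith) (Real.exp_pos _) (by positivity)
  nlinarith [abs_nonneg (P x - P s)]

theorem greenKernel_le_greenKernel (P : ℝ → ℝ) {κ κ' : ℝ} (hκ : 0 < κ) (h : κ < κ') (x s : ℝ) :
    greenKernel P κ' x s ≤ greenKernel P κ x s := by
  by_cases hxs : x ∈ Ioo (-1 : ℝ) 1 ∧ s ∈ Ioo (-1 : ℝ) 1
  · exact (greenKernel_lt_greenKernel P hκ h hxs.1 hxs.2).le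
  · simp only [greenKernel, hxs, if_false, le_refl]

theorem continuousOn_greenKernel {P : ℝ → ℝ} (hP : ContinuousOn P (Ioo (-1) 1))
    (hP₁ : Tendsto P (nhdsWithin 1 (Iio 1)) atTop)
    (hP₀ : Tendsto P (nhdsWithin (-1) (Ioi (-1))) atBot) {κ : ℝ} (hκ : 0 < κ) (s : ℝ) :
    ContinuousOn (fun x => greenKernel P κ x s) (Icc (-1) 1) := by
  by_cases hs : s ∈ Ioo (-1 : ℝ) 1
  swap
  · simpa [greenKernel, hs] using continuousOn_const
  have heq : EqOn (fun x => greenKernel P κ x s)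
      (fun x => Real.exp (-κ * |P x - P s|) / (2 * κ)) (Ioo (-1) 1) :=
    fun x hx => greenKernel_of_mem hx hs
  have hlim {l : Filter ℝ} (h : Tendsto (fun x => |P x - P s|) l atTop) :
      Tendsto (fun x => Real.exp (-κ * |P x - P s|) / (2 * κ)) l (nhds 0) := by
    have := (Real.tendsto_exp_atBot.comp (h.const_mul_atTop_of_neg (neg_lt_zero.2 hκ))).div_const
      (2 * κ)
    simpa [Function.comp_def] using this
  intro x hx
  rcases eq_or_lt_of_le hx.1 with rfl | hx0
  · rw [← continuousWithinAt_sdiff_self, ContinuousWithinAt]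
    have hzero : greenKernel P κ (-1) s = 0 := by simp [greenKernel]
    rw [hzero]
    have hmain : Tendsto (fun x => greenKernel P κ x s) (nhdsWithin (-1) (Ioi (-1))) (nhds 0) := by
      refine (hlim (tendsto_abs_atBot_atTop.comp
        (tendsto_atBot_add_const_right _ (-P s) hP₀))).congr' ?_
      filter_upwards [Ioo_mem_nhdsGT (show (-1 : ℝ) < 1 by norm_num)] with y hy
      exact (heq hy).symm
    exact hmain.mono_left (nhdsWithin_mono _ fun y hy => lt_of_le_of_ne hy.1.1 (Ne.symm hy.2))
  rcases eq_or_lt_of_le hx.2 with rfl | hx1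
  · rw [← continuousWithinAt_sdiff_self, ContinuousWithinAt]
    have hzero : greenKernel P κ 1 s = 0 := by simp [greenKernel]
    rw [hzero]
    have hmain : Tendsto (fun x => greenKernel P κ x s) (nhdsWithin 1 (Iio 1)) (nhds 0) := by
      refine (hlim (tendsto_abs_atTop_atTop.comp
        (tendsto_atTop_add_const_right _ (-P s) hP₁))).congr' ?_
      filter_upwards [Ioo_mem_nhdsLT (show (-1 : ℝ) < 1 by norm_num)] with y hy
      exact (heq hy).symm
    exact hmain.mono_left (nhdsWithin_mono _ fun y hy => lt_of_le_of_ne hy.1.2 hy.2)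
  · have hc : ContinuousOn (fun x => Real.exp (-κ * |P x - P s|) / (2 * κ)) (Ioo (-1) 1) := by
      fun_prop
    exact ((hc.congr heq).continuousAt (Ioo_mem_nhds hx0 hx1)).continuousWithinAt

theorem continuousOn_greenKernel_mul {P : ℝ → ℝ} (hP : ContinuousOn P (Ioo (-1) 1))
    (hP₁ : Tendsto P (nhdsWithin 1 (Iio 1)) atTop)
    (hP₀ : Tendsto P (nhdsWithin (-1) (Ioi (-1))) atBot) {κ : ℝ} (hκ : 0 < κ) {w : ℝ → ℝ}
    (hw : ContinuousOn w (Icc (-1) 1)) (x : ℝ) :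
    ContinuousOn (fun s => greenKernel P κ x s * w s) (Icc (-1) 1) := by
  simp_rw [greenKernel_comm P κ x]
  exact (continuousOn_greenKernel hP hP₁ hP₀ hκ x).mul hw

theorem continuousOn_integral_greenKernel_mul {P : ℝ → ℝ} (hP : ContinuousOn P (Ioo (-1) 1))
    (hP₁ : Tendsto P (nhdsWithin 1 (Iio 1)) atTop)
    (hP₀ : Tendsto P (nhdsWithin (-1) (Ioi (-1))) atBot) {κ : ℝ} (hκ : 0 < κ) {w : ℝ → ℝ}
    (hw : ContinuousOn w (Icc (-1) 1)) :
    ContinuousOn (fun x => ∫ s in (-1 : ℝ)..1, greenKernel P κ x s * w s) (Icc (-1) 1) := by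
  obtain ⟨M, hM⟩ := isCompact_Icc.exists_bound_of_continuousOn hw
  simp_rw [intervalIntegral.integral_of_le (show (-1 : ℝ) ≤ 1 by norm_num)]
  refine continuousOn_of_dominated (bound := fun _ => 1 / (2 * κ) * M) ?_ ?_
    (integrable_const _) ?_
  · intro x _
    exact ((continuousOn_greenKernel_mul hP hP₁ hP₀ hκ hw x).mono
      Ioc_subset_Icc_self).aestronglyMeasurable measurableSet_Ioc
  · intro x _
    refine (ae_restrict_iff' measurableSet_Ioc).2 (Eventually.of_forall fun s hs => ?_)
    rw [norm_mul]
    gcongr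
    · exact abs_greenKernel_le P hκ x s
    · exact hM s (Ioc_subset_Icc_self hs)
  · exact Eventually.of_forall fun s =>
      (continuousOn_greenKernel hP hP₁ hP₀ hκ s).mul continuousOn_const

/-- The Green kernel inverts the Sturm–Liouville operator: `U = ∫ G w` satisfies
`-(f U')' + κ² / f U = w`, written as a first order system with `z = f U'`. -/
theorem exists_hasDerivAt_integral_greenKernel_mul {f P : ℝ → ℝ}
    (hpos : ∀ x ∈ Ioo (-1 : ℝ) 1, 0 < f x)
    (hP : ∀ x ∈ Ioo (-1 : ℝ) 1, HasDerivAt P (f x)⁻¹ x)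
    (hP₁ : Tendsto P (nhdsWithin 1 (Iio 1)) atTop)
    (hP₀ : Tendsto P (nhdsWithin (-1) (Ioi (-1))) atBot) {κ : ℝ} (hκ : 0 < κ) {w : ℝ → ℝ}
    (hw : ContinuousOn w (Icc (-1) 1)) :
    ∃ z : ℝ → ℝ, ∀ x ∈ Ioo (-1 : ℝ) 1,
      HasDerivAt (fun x => ∫ s in (-1 : ℝ)..1, greenKernel P κ x s * w s) (z x / f x) x ∧
      HasDerivAt z (κ ^ 2 / f x * (∫ s in (-1 : ℝ)..1, greenKernel P κ x s * w s) - w x) x := by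
  have hPc : ContinuousOn P (Ioo (-1) 1) := fun x hx => (hP x hx).continuousAt.continuousWithinAt
  have hmono : MonotoneOn P (Ioo (-1) 1) := by
    refine monotoneOn_of_deriv_nonneg (convex_Ioo _ _) hPc ?_ ?_ <;> rw [interior_Ioo]
    · exact fun x hx => (hP x hx).differentiableAt.differentiableWithinAt
    · exact fun x hx => by rw [(hP x hx).deriv]; exact (inv_pos.2 (hpos x hx)).le
  have hGw (x : ℝ) {a b : ℝ} (ha : a ∈ Icc (-1 : ℝ) 1) (hb : b ∈ Icc (-1 : ℝ) 1) :
      IntervalIntegrable (fun s => greenKernel P κ x s * w s) volume a b :=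
    ((continuousOn_greenKernel_mul hPc hP₁ hP₀ hκ hw x).mono
      (ordConnected_Icc.uIcc_subset ha hb)).intervalIntegrable
  have hl : (-1 : ℝ) ∈ Icc (-1 : ℝ) 1 := by norm_num
  have hr : (1 : ℝ) ∈ Icc (-1 : ℝ) 1 := by norm_num
  have hleft {x : ℝ} (hx : x ∈ Ioo (-1 : ℝ) 1) :
      EqOn (fun s => greenKernel P κ x s * w s)
        (fun s => Real.exp (-κ * P x) / (2 * κ) * (Real.exp (κ * P s) * w s)) (Ioo (-1) x) := by
    intro s hs
    have hs' : s ∈ Ioo (-1 : ℝ) 1 := ⟨hs.1, hs.2.trans hx.2⟩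
    simp only
    rw [greenKernel_of_mem hx hs', abs_of_nonneg (sub_nonneg.2 (hmono hs' hx hs.2.le)),
      show -κ * (P x - P s) = -κ * P x + κ * P s by ring, Real.exp_add]
    ring
  have hright {x : ℝ} (hx : x ∈ Ioo (-1 : ℝ) 1) :
      EqOn (fun s => greenKernel P κ x s * w s)
        (fun s => Real.exp (κ * P x) / (2 * κ) * (Real.exp (-κ * P s) * w s)) (Ioo x 1) := by
    intro s hs
    have hs' : s ∈ Ioo (-1 : ℝ) 1 := ⟨hx.1.trans hs.1, hs.2⟩
    simp only
    rw [greenKernel_of_mem hx hs', abs_of_nonpos (sub_nonpos.2 (hmono hx hs' hs.1.le)),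
      show -κ * -(P x - P s) = κ * P x + -κ * P s by ring, Real.exp_add]
    ring
  set a : ℝ → ℝ := fun x => ∫ s in (-1 : ℝ)..x, Real.exp (κ * P s) * w s with ha
  set b : ℝ → ℝ := fun x => ∫ s in x..1, Real.exp (-κ * P s) * w s with hb
  have hU : ∀ x ∈ Ioo (-1 : ℝ) 1, (∫ s in (-1 : ℝ)..1, greenKernel P κ x s * w s) =
      Real.exp (-κ * P x) / (2 * κ) * a x + Real.exp (κ * P x) / (2 * κ) * b x := by
    intro x hx
    have hx' := Ioo_subset_Icc_self hx
    rw [← intervalIntegral.integral_add_adjacent_intervals (hGw x hl hx') (hGw x hx' hr),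
      intervalIntegral.integral_congr_Ioo_of_le hx.1.le (hleft hx),
      intervalIntegral.integral_congr_Ioo_of_le hx.2.le (hright hx),
      intervalIntegral.integral_const_mul, intervalIntegral.integral_const_mul]
  have hcont (c : ℝ) : ContinuousOn (fun s => Real.exp (c * P s) * w s) (Ioo (-1) 1) :=
    (by fun_prop : ContinuousOn (fun s => Real.exp (c * P s)) (Ioo (-1) 1)).mul
      (hw.mono Ioo_subset_Icc_self)
  have hda : ∀ x ∈ Ioo (-1 : ℝ) 1, HasDerivAt a (Real.exp (κ * P x) * w x) x := by
    intro x hx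
    refine intervalIntegral.integral_hasDerivAt_right ?_
      ((hcont κ).stronglyMeasurableAtFilter isOpen_Ioo x hx)
      ((hcont κ).continuousAt (isOpen_Ioo.mem_nhds hx))
    have h := (hGw x hl (Ioo_subset_Icc_self hx)).congr_uIoo
      (by rw [uIoo_of_le hx.1.le]; exact hleft hx)
    rw [intervalIntegrable_iff] at h ⊢
    exact (integrable_const_mul_iff (IsUnit.mk0 _ (by positivity)) _).1 h
  have hdb : ∀ x ∈ Ioo (-1 : ℝ) 1, HasDerivAt b (-(Real.exp (-κ * P x) * w x)) x := by
    intro x hx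
    refine intervalIntegral.integral_hasDerivAt_left ?_
      ((hcont (-κ)).stronglyMeasurableAtFilter isOpen_Ioo x hx)
      ((hcont (-κ)).continuousAt (isOpen_Ioo.mem_nhds hx))
    have h := (hGw x (Ioo_subset_Icc_self hx) hr).congr_uIoo
      (by rw [uIoo_of_le hx.2.le]; exact hright hx)
    rw [intervalIntegrable_iff] at h ⊢
    exact (integrable_const_mul_iff (IsUnit.mk0 _ (by positivity)) _).1 h
  have hde (c : ℝ) {x : ℝ} (hx : x ∈ Ioo (-1 : ℝ) 1) :
      HasDerivAt (fun x => Real.exp (c * P x)) (Real.exp (c * P x) * (c * (f x)⁻¹)) x :=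
    ((hP x hx).const_mul c).exp
  have hcancel (x : ℝ) : Real.exp (-κ * P x) * Real.exp (κ * P x) = 1 := by
    rw [← Real.exp_add]; simp
  refine ⟨fun x => (Real.exp (κ * P x) * b x - Real.exp (-κ * P x) * a x) / 2, fun x hx => ⟨?_, ?_⟩⟩
  · have hf0 := (hpos x hx).ne'
    refine (((((hde (-κ) hx).div_const (2 * κ)).mul (hda x hx)).add
      (((hde κ hx).div_const (2 * κ)).mul (hdb x hx))).congr_of_eventuallyEq ?_).congr_deriv ?_
    · filter_upwards [isOpen_Ioo.mem_nhds hx] with y hy using hU y hy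
    · field_simp
      ring
  · have hf0 := (hpos x hx).ne'
    refine ((((hde κ hx).mul (hdb x hx)).sub
      ((hde (-κ) hx).mul (hda x hx))).div_const 2).congr_deriv ?_
    rw [hU x hx]
    have := hcancel x
    generalize Real.exp (-κ * P x) = p at *
    generalize Real.exp (κ * P x) = q at *
    field_simp
    linear_combination (-2 * f x * w x) * this

/-- Below every eigenvalue of `L_l` there is an eigenvalue of `L_k`, if `1 ≤ k < l`. -/
theorem exists_eigenvalue_lt_of_mem_spec {f : ℝ → ℝ} (hf : IsProfile f) {k l : ℕ} (hk : 1 ≤ k)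
    (hkl : k < l) {mu : ℝ} (hmu : mu ∈ Spec f l) : ∃ lam ∈ Spec f k, lam < mu := by
  obtain ⟨P, hP, hP₁, hP₀⟩ := hf.exists_primitive_inv
  have hPc : ContinuousOn P (Ioo (-1) 1) := fun x hx => (hP x hx).continuousAt.continuousWithinAt
  have hk0 : (0 : ℝ) < k := by exact_mod_cast hk
  have hkl' : (k : ℝ) < l := by exact_mod_cast hkl
  have hl0 : (0 : ℝ) < l := hk0.trans hkl'
  obtain ⟨v, hvc, hvs, ⟨x₀, hx₀, hvx₀⟩, hbc, hv⟩ := hmu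
  obtain ⟨hv₀, hv₁⟩ := hbc (hk.trans hkl.le)
  have hdv : ∀ x ∈ Ioo (-1 : ℝ) 1, HasDerivAt v (f x * deriv v x / f x) x := by
    intro x hx
    rw [mul_div_cancel_left₀ _ (hf.pos x hx).ne']
    exact ((hvs.differentiableOn (by simp)).differentiableAt (isOpen_Ioo.mem_nhds hx)).hasDerivAt
  have hdz : ∀ x ∈ Ioo (-1 : ℝ) 1,
      HasDerivAt (fun y => f y * deriv v y) (((l : ℝ) ^ 2 / f x - mu) * v x) x := by
    intro x hx
    have hd : DifferentiableAt ℝ (fun y => f y * deriv v y) x := by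
      have hf' : DifferentiableAt ℝ f x :=
        (hf.smoothOn.differentiableOn (by simp)).differentiableAt (isOpen_Ioo.mem_nhds hx)
      have hv' : ContDiffOn ℝ 1 (deriv v) (Ioo (-1) 1) :=
        ((contDiffOn_succ_iff_deriv_of_isOpen (n := 1) isOpen_Ioo).1
          (hvs.of_le (by norm_cast))).2.2
      exact hf'.mul
        ((hv'.differentiableOn (by simp)).differentiableAt (isOpen_Ioo.mem_nhds hx))
    exact hd.hasDerivAt.congr_deriv (by linarith [hv x hx])
  have hmu0 : 0 < mu := by
    by_contra! hmu0
    refine hvx₀ (eqOn_zero_of_sturm hf.pos (fun x hx => ?_) hvc hv₀ hv₁ hdv hdz x₀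
      (Ioo_subset_Icc_self hx₀))
    have : 0 < (l : ℝ) ^ 2 / f x := div_pos (by positivity) (hf.pos x hx)
    linarith
  have hzero (κ : ℝ) (w : ℝ → ℝ) {x : ℝ} (hx : x ∉ Ioo (-1 : ℝ) 1) :
      ∫ s in (-1 : ℝ)..1, greenKernel P κ x s * w s = 0 := by
    simp only [greenKernel, hx, false_and, if_false, zero_mul, intervalIntegral.integral_zero]
  have hvG : ∀ x ∈ Icc (-1 : ℝ) 1,
      v x = mu * ∫ s in (-1 : ℝ)..1, greenKernel P l x s * v s := by
    obtain ⟨z, hz⟩ := exists_hasDerivAt_integral_greenKernel_mul hf.pos hP hP₁ hP₀ hl0 hvc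
    intro x hx
    refine sub_eq_zero.1 (eqOn_zero_of_sturm
      (w := fun x => v x - mu * ∫ s in (-1 : ℝ)..1, greenKernel P l x s * v s)
      (z := fun x => f x * deriv v x - mu * z x) (q := fun x => (l : ℝ) ^ 2 / f x)
      hf.pos (fun x hx => div_pos (by positivity) (hf.pos x hx))
      (hvc.sub ((continuousOn_integral_greenKernel_mul hPc hP₁ hP₀ hl0 hvc).const_mul mu))
      ?_ ?_ (fun x hx => ?_) (fun x hx => ?_) x hx)
    · rw [hzero _ _ (by simp), hv₀]; simp
    · rw [hzero _ _ (by simp), hv₁]; simp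
    · exact ((hdv x hx).sub ((hz x hx).1.const_mul mu)).congr_deriv (by ring)
    · exact ((hdz x hx).sub ((hz x hx).2.const_mul mu)).congr_deriv (by ring)
  have hac : ContinuousOn (fun s => |v s|) (Icc (-1) 1) := hvc.abs
  have hGw {κ : ℝ} (hκ : 0 < κ) {w : ℝ → ℝ} (hw : ContinuousOn w (Icc (-1) 1)) (x : ℝ) :
      IntervalIntegrable (fun s => greenKernel P κ x s * w s) volume (-1) 1 :=
    (continuousOn_greenKernel_mul hPc hP₁ hP₀ hκ hw x).intervalIntegrable_of_Icc (by norm_num)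
  have habs : ∀ x ∈ Icc (-1 : ℝ) 1,
      |v x| ≤ mu * ∫ s in (-1 : ℝ)..1, greenKernel P l x s * |v s| := by
    intro x hx
    rw [hvG x hx, abs_mul, abs_of_pos hmu0]
    gcongr
    refine (intervalIntegral.abs_integral_le_integral_abs (by norm_num)).trans_eq ?_
    simp only [abs_mul, abs_of_nonneg (greenKernel_nonneg P hl0 _ _)]
  have hle : ∀ x ∈ Icc (-1 : ℝ) 1,
      |v x| ≤ mu * ∫ s in (-1 : ℝ)..1, greenKernel P k x s * |v s| := by
    intro x hx
    refine (habs x hx).trans ?_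
    gcongr
    refine intervalIntegral.integral_mono_on (by norm_num) (hGw hl0 hac x) (hGw hk0 hac x) ?_
    intro s _
    gcongr
    exact greenKernel_le_greenKernel P hk0 hkl' x s
  have hlt : |v x₀| < mu * ∫ s in (-1 : ℝ)..1, greenKernel P k x₀ s * |v s| := by
    refine (habs x₀ (Ioo_subset_Icc_self hx₀)).trans_lt ?_
    gcongr
    refine intervalIntegral.integral_lt_integral_of_continuousOn_of_le_of_exists_lt (by norm_num)
      (continuousOn_greenKernel_mul hPc hP₁ hP₀ hl0 hac x₀)
      (continuousOn_greenKernel_mul hPc hP₁ hP₀ hk0 hac x₀) ?_ ⟨x₀, Ioo_subset_Icc_self hx₀, ?_⟩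
    · intro s _
      gcongr
      exact greenKernel_le_greenKernel P hk0 hkl' x₀ s
    · have : 0 < |v x₀| := by positivity
      gcongr
      exact greenKernel_lt_greenKernel P hk0 hkl' hx₀ hx₀
  have hquad : mu⁻¹ * ∫ x in (-1 : ℝ)..1, |v x| ^ 2 <
      ∫ x in (-1 : ℝ)..1, (∫ s in (-1 : ℝ)..1, greenKernel P k x s * |v s|) * |v x| := by
    rw [← intervalIntegral.integral_const_mul]
    refine intervalIntegral.integral_lt_integral_of_continuousOn_of_le_of_exists_lt (by norm_num)
      (by fun_prop) ((continuousOn_integral_greenKernel_mul hPc hP₁ hP₀ hk0 hac).mul hac) ?_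
      ⟨x₀, Ioo_subset_Icc_self hx₀, ?_⟩
    · intro x hx
      rw [sq, ← mul_assoc]
      gcongr
      exact (inv_mul_le_iff₀ hmu0).2 (hle x (Ioc_subset_Icc_self hx))
    · have : 0 < |v x₀| := by positivity
      rw [sq, ← mul_assoc]
      gcongr
      exact (inv_mul_lt_iff₀ hmu0).2 hlt
  let ν : Measure (Icc (-1 : ℝ) 1) := Measure.comap Subtype.val volume
  have hν : IsFiniteMeasure ν := by
    refine ⟨?_⟩
    rw [(MeasurableEmbedding.subtype_coe measurableSet_Icc).comap_apply, image_univ,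
      Subtype.range_coe]
    exact isCompact_Icc.measure_lt_top
  have hsub (φ : ℝ → ℝ) : ∫ x, φ x ∂ν = ∫ x in (-1 : ℝ)..1, φ x := by
    rw [intervalIntegral.integral_of_le (by norm_num), ← integral_Icc_eq_integral_Ioc]
    exact integral_subtype_comap measurableSet_Icc φ
  have hac' : Continuous fun x : Icc (-1 : ℝ) 1 => |v x| :=
    continuousOn_iff_continuous_domRestrict.1 hac
  obtain ⟨r, hr, w, hw0, hw⟩ := exists_continuous_eigenfunction_of_lt_integral
    (X := Icc (-1 : ℝ) 1) ν (G := fun x s => greenKernel P k x s)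
    (fun s => continuousOn_iff_continuous_domRestrict.1
      (continuousOn_greenKernel hPc hP₁ hP₀ hk0 s))
    (fun x s => greenKernel_comm P k x s) (fun x s => abs_greenKernel_le P hk0 x s)
    (inv_pos.2 hmu0).le ⟨fun x => |v x|, hac'⟩ (by
      simp only [ContinuousMap.coe_mk]
      rw [hsub fun x => |v x| ^ 2]
      simp_rw [fun x : ℝ => hsub fun s => greenKernel P k x s * |v s|]
      rw [hsub fun x => (∫ s in (-1 : ℝ)..1, greenKernel P k x s * |v s|) * |v x|]
      exact hquad)
  have hr0 : 0 < r := (inv_pos.2 hmu0).trans hr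
  set u : ℝ → ℝ := IccExtend (show (-1 : ℝ) ≤ 1 by norm_num) w
  have huc : ContinuousOn u (Icc (-1) 1) := w.continuous.Icc_extend'.continuousOn
  have huw (x : Icc (-1 : ℝ) 1) : u x = w x := IccExtend_val _ _ x
  have huG : ∀ x ∈ Icc (-1 : ℝ) 1,
      u x = r⁻¹ * ∫ s in (-1 : ℝ)..1, greenKernel P k x s * u s := by
    intro x hx
    have h := hw ⟨x, hx⟩
    simp_rw [← huw] at h
    rw [hsub fun s => greenKernel P k x s * u s] at h
    rw [h, inv_mul_cancel_left₀ hr0.ne']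
  obtain ⟨z, hz⟩ := exists_hasDerivAt_integral_greenKernel_mul hf.pos hP hP₁ hP₀ hk0 huc
  have hdu : ∀ x ∈ Ioo (-1 : ℝ) 1, HasDerivAt u (r⁻¹ * z x / f x) x := by
    intro x hx
    refine (((hz x hx).1.const_mul r⁻¹).congr_of_eventuallyEq ?_).congr_deriv (by ring)
    filter_upwards [isOpen_Ioo.mem_nhds hx] with y hy using huG y (Ioo_subset_Icc_self hy)
  have hdz : ∀ x ∈ Ioo (-1 : ℝ) 1,
      HasDerivAt (fun x => r⁻¹ * z x) (((k : ℝ) ^ 2 / f x - r⁻¹) * u x) x := by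
    intro x hx
    refine ((hz x hx).2.const_mul r⁻¹).congr_deriv ?_
    linear_combination (-(k : ℝ) ^ 2 / f x) * huG x (Ioo_subset_Icc_self hx)
  have hu₀ : u (-1) = 0 := by rw [huG _ (by norm_num), hzero _ _ (by simp), mul_zero]
  have hu₁ : u 1 = 0 := by rw [huG _ (by norm_num), hzero _ _ (by simp), mul_zero]
  refine ⟨r⁻¹, ⟨u, huc, ?_, ?_, fun _ => ⟨hu₀, hu₁⟩, fun x hx => ?_⟩, ?_⟩
  · exact contDiffOn_of_sturm hf.smoothOn hf.pos
      ((contDiffOn_const.div hf.smoothOn fun x hx => (hf.pos x hx).ne').sub contDiffOn_const)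
      hdu hdz
  · by_contra! h
    refine hw0 (ContinuousMap.ext fun x => ?_)
    rw [ContinuousMap.zero_apply, ← huw]
    by_cases hx : (x : ℝ) ∈ Ioo (-1 : ℝ) 1
    · exact h x hx
    · rw [huG x x.2, hzero _ _ hx, mul_zero]
  · have hev : (fun y => f y * deriv u y) =ᶠ[nhds x] fun y => r⁻¹ * z y := by
      filter_upwards [isOpen_Ioo.mem_nhds hx] with y hy
      rw [(hdu y hy).deriv, mul_div_cancel₀ _ (hf.pos y hy).ne']
    rw [hev.deriv_eq, (hdz x hx).deriv]
    ring
  · exact inv_lt_of_inv_lt₀ hmu0 hr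

/-- Monotonicity of the first eigenvalue: if `1 ≤ k < l`, the least eigenvalue of `L_k`
is strictly smaller than the least eigenvalue of `L_l`. -/
theorem first_eigenvalue_monotone (f : ℝ → ℝ) (hf : IsProfile f)
    (k l : ℕ) (hk : 1 ≤ k) (hkl : k < l)
    (lam mu : ℝ) (hlam : IsLeast (Spec f k) lam) (hmu : IsLeast (Spec f l) mu) :
    lam < mu := by
  obtain ⟨lam', hlam', hlt⟩ := exists_eigenvalue_lt_of_mem_spec hf hk hkl hmu.1
  exact (hlam.2 hlam').trans_lt hlt
end

section
/- Let f be a profile function, let Λ : ℕ → ℝ be the strictly increasing enumeration of the set E(f) = ⋃_{k ≥ 0} Spec L_k of distinct Laplace eigenvalues, let k ≥ 1 be an integer, and let μ : ℕ → ℝ be the strictly increasing enumeration of Spec L_k. Then for every j ≥ 0, Λ(k + j) ≤ μ(j); that is, the (k+j)-th distinct eigenvalue λ_{k+j} of the Laplacian satisfies λ_{k+j} ≤ λ_k^{j+1}. -/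
open Set MeasureTheory intervalIntegral Filter

open scoped Topology ENNReal

/-- Maximum principle for `(f w')' = c w` with `c > 0`, written as a first order system. -/
lemma nonpos_of_system {f w p c : ℝ → ℝ} (hfpos : ∀ x ∈ Ioo (-1 : ℝ) 1, 0 < f x)
    (hcont : ContinuousOn w (Icc (-1) 1)) (hl : w (-1) = 0) (hr : w 1 = 0)
    (hw : ∀ x ∈ Ioo (-1 : ℝ) 1, HasDerivAt w (p x / f x) x)
    (hp : ∀ x ∈ Ioo (-1 : ℝ) 1, HasDerivAt p (c x * w x) x)
    (hc : ∀ x ∈ Ioo (-1 : ℝ) 1, 0 < c x) :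
    ∀ x ∈ Icc (-1 : ℝ) 1, w x ≤ 0 := by
  obtain ⟨z, hz, hmax⟩ := isCompact_Icc.exists_isMaxOn (nonempty_Icc.2 (by norm_num)) hcont
  by_contra! hcon
  obtain ⟨y, hy, hwy⟩ := hcon
  have hwz : 0 < w z := hwy.trans_le (hmax hy)
  have hz' : z ∈ Ioo (-1 : ℝ) 1 := by
    refine ⟨lt_of_le_of_ne hz.1 ?_, lt_of_le_of_ne hz.2 ?_⟩
    · rintro rfl
      exact hwz.ne' hl
    · rintro rfl
      exact hwz.ne' hr
  have hloc : IsLocalMax w z := hmax.isLocalMax (Icc_mem_nhds hz'.1 hz'.2)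
  have hpz : p z = 0 := by
    have h0 := hloc.hasDerivAt_eq_zero (hw z hz')
    have := (hfpos z hz').ne'
    field_simp at h0
    simpa using h0
  have hslope := (hasDerivAt_iff_tendsto_slope.1 (hp z hz')).eventually
    (lt_mem_nhds (mul_pos (hc z hz') hwz))
  have hright : ∀ᶠ x in 𝓝[>] z, 0 < slope p z x :=
    nhdsWithin_mono z (fun x (hx : z < x) => (ne_of_gt hx : x ≠ z)) hslope
  obtain ⟨b, hb, hsub⟩ := (mem_nhdsGT_iff_exists_Ioo_subset' hz'.2).1
    (hright.and (Ioo_mem_nhdsGT hz'.2))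
  obtain ⟨d, hzd, hdb⟩ := exists_between (mem_Ioi.1 hb)
  have hd1 : d < 1 := (hsub ⟨hzd, hdb⟩).2.2
  have hmono : StrictMonoOn w (Icc z d) := by
    refine strictMonoOn_of_deriv_pos (convex_Icc z d)
      (hcont.mono (Icc_subset_Icc hz.1 hd1.le)) fun x hx => ?_
    rw [interior_Icc] at hx
    have hx1 : x ∈ Ioo (-1 : ℝ) 1 := ⟨hz'.1.trans hx.1, hx.2.trans hd1⟩
    rw [(hw x hx1).deriv]
    have hs : 0 < slope p z x := (hsub ⟨hx.1, hx.2.trans hdb⟩).1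
    rw [slope_def_field, hpz, sub_zero] at hs
    have : 0 < p x := by
      have := mul_pos hs (sub_pos.2 hx.1)
      rwa [div_mul_cancel₀ _ (sub_pos.2 hx.1).ne'] at this
    exact div_pos this (hfpos x hx1)
  exact (hmono (left_mem_Icc.2 hzd.le) (right_mem_Icc.2 hzd.le) hzd).not_ge
    (hmax ⟨hz.1.trans hzd.le, hd1.le⟩)

lemma eq_zero_of_system {f w p c : ℝ → ℝ} (hfpos : ∀ x ∈ Ioo (-1 : ℝ) 1, 0 < f x)
    (hcont : ContinuousOn w (Icc (-1) 1)) (hl : w (-1) = 0) (hr : w 1 = 0)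
    (hw : ∀ x ∈ Ioo (-1 : ℝ) 1, HasDerivAt w (p x / f x) x)
    (hp : ∀ x ∈ Ioo (-1 : ℝ) 1, HasDerivAt p (c x * w x) x)
    (hc : ∀ x ∈ Ioo (-1 : ℝ) 1, 0 < c x) :
    ∀ x ∈ Icc (-1 : ℝ) 1, w x = 0 := by
  intro x hx
  refine le_antisymm (nonpos_of_system hfpos hcont hl hr hw hp hc x hx) ?_
  have := nonpos_of_system (w := fun y => -w y) (p := fun y => -p y) hfpos hcont.neg
    (by simp [hl]) (by simp [hr]) (fun y hy => (hw y hy).neg.congr_deriv (by ring))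
    (fun y hy => (hp y hy).neg.congr_deriv (by ring)) hc x hx
  linarith

/-- Solutions of the system `w' = b p`, `p' = a w` are as smooth as the coefficients. -/
lemma contDiffOn_of_system {w p a b : ℝ → ℝ} {s : Set ℝ} (hs : IsOpen s)
    (ha : ContDiffOn ℝ (⊤ : ℕ∞) a s) (hb : ContDiffOn ℝ (⊤ : ℕ∞) b s)
    (hw : ∀ x ∈ s, HasDerivAt w (b x * p x) x) (hp : ∀ x ∈ s, HasDerivAt p (a x * w x) x) :
    ContDiffOn ℝ (⊤ : ℕ∞) w s := by
  have key : ∀ n : ℕ, ContDiffOn ℝ n w s ∧ ContDiffOn ℝ n p s := by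
    intro n
    induction n with
    | zero =>
      exact ⟨contDiffOn_zero.2 fun x hx => (hw x hx).continuousAt.continuousWithinAt,
        contDiffOn_zero.2 fun x hx => (hp x hx).continuousAt.continuousWithinAt⟩
    | succ n ih =>
      have step : ∀ {v q e : ℝ → ℝ}, ContDiffOn ℝ (⊤ : ℕ∞) e s → ContDiffOn ℝ n q s →
          (∀ x ∈ s, HasDerivAt v (e x * q x) x) → ContDiffOn ℝ (n + 1 : ℕ) v s := by
        intro v q e he hq hv
        push_cast
        rw [contDiffOn_succ_iff_deriv_of_isOpen hs]
        refine ⟨fun x hx => (hv x hx).differentiableAt.differentiableWithinAt, by simp, ?_⟩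
        exact ((he.of_le (by exact_mod_cast le_top)).mul hq).congr fun x hx => (hv x hx).deriv
      exact ⟨step hb ih.2 hw, step ha ih.1 hp⟩
  exact contDiffOn_infty.2 fun n => (key n).1

lemma InSpec.exists_system {f : ℝ → ℝ} (hf : IsProfile f) {k : ℕ} {lam : ℝ}
    (h : InSpec f k lam) :
    ∃ u p : ℝ → ℝ, ContinuousOn u (Icc (-1) 1) ∧ (∃ x ∈ Ioo (-1 : ℝ) 1, u x ≠ 0) ∧
      (1 ≤ k → u (-1) = 0 ∧ u 1 = 0) ∧
      (∀ x ∈ Ioo (-1 : ℝ) 1, HasDerivAt u (p x / f x) x) ∧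
      ∀ x ∈ Ioo (-1 : ℝ) 1, HasDerivAt p (((k : ℝ) ^ 2 / f x - lam) * u x) x := by
  obtain ⟨u, hc, hs, hne, hb, he⟩ := h
  refine ⟨u, fun y => f y * deriv u y, hc, hne, hb, fun x hx => ?_, fun x hx => ?_⟩
  · rw [mul_div_cancel_left₀ _ (hf.pos x hx).ne']
    exact ((hs.differentiableOn (by simp)).differentiableAt (isOpen_Ioo.mem_nhds hx)).hasDerivAt
  · have hd : DifferentiableAt ℝ (fun y => f y * deriv u y) x := by
      refine ((hf.smoothOn.differentiableOn (by simp)).differentiableAt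
        (isOpen_Ioo.mem_nhds hx)).mul ?_
      have := ((contDiffOn_infty_iff_deriv_of_isOpen isOpen_Ioo).1 hs).2
      exact (this.differentiableOn (by simp)).differentiableAt (isOpen_Ioo.mem_nhds hx)
    have := he x hx
    refine hd.hasDerivAt.congr_deriv ?_
    rw [sub_mul]
    linarith

lemma InSpec.of_system {f : ℝ → ℝ} (hf : IsProfile f) {k : ℕ} {lam : ℝ} {u p : ℝ → ℝ}
    (hc : ContinuousOn u (Icc (-1) 1)) (hne : ∃ x ∈ Ioo (-1 : ℝ) 1, u x ≠ 0)
    (hb : 1 ≤ k → u (-1) = 0 ∧ u 1 = 0)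
    (hu : ∀ x ∈ Ioo (-1 : ℝ) 1, HasDerivAt u (p x / f x) x)
    (hp : ∀ x ∈ Ioo (-1 : ℝ) 1, HasDerivAt p (((k : ℝ) ^ 2 / f x - lam) * u x) x) :
    InSpec f k lam := by
  have hinv : ContDiffOn ℝ (⊤ : ℕ∞) (fun x => (f x)⁻¹) (Ioo (-1) 1) :=
    hf.smoothOn.inv fun x hx => (hf.pos x hx).ne'
  refine ⟨u, hc, ?_, hne, hb, fun x hx => ?_⟩
  · refine contDiffOn_of_system isOpen_Ioo (a := fun x => (k : ℝ) ^ 2 / f x - lam) ?_ hinv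
      (fun x hx => by simpa [div_eq_inv_mul] using hu x hx) hp
    simpa only [div_eq_mul_inv] using (contDiffOn_const.mul hinv).sub contDiffOn_const
  · have heq : (fun y => f y * deriv u y) =ᶠ[𝓝 x] p := by
      filter_upwards [isOpen_Ioo.mem_nhds hx] with y hy
      rw [(hu y hy).deriv, mul_div_cancel₀ _ (hf.pos y hy).ne']
    rw [heq.deriv_eq, (hp x hx).deriv]
    ring

lemma InSpec.pos {f : ℝ → ℝ} (hf : IsProfile f) {k : ℕ} (hk : 1 ≤ k) {lam : ℝ}
    (h : InSpec f k lam) : 0 < lam := by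
  obtain ⟨u, p, hc, ⟨x, hx, hne⟩, hb, hu, hp⟩ := h.exists_system hf
  by_contra! hlam
  have hk' : (0 : ℝ) < k := by exact_mod_cast hk
  refine hne (eq_zero_of_system hf.pos hc (hb hk).1 (hb hk).2 hu hp (fun y hy => ?_) x
    (Ioo_subset_Icc_self hx))
  have := div_pos (pow_pos hk' 2) (hf.pos y hy)
  linarith

lemma inSpec_zero (f : ℝ → ℝ) : InSpec f 0 0 :=
  ⟨fun _ => 1, continuousOn_const, contDiffOn_const, ⟨0, by norm_num, one_ne_zero⟩, by simp,
    by simp⟩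

/-- A coordinate on `(-1, 1)` in which the surface metric is conformal to a cylinder. -/
structure IsConformalCoord (f t : ℝ → ℝ) : Prop where
  hasDerivAt : ∀ x ∈ Ioo (-1 : ℝ) 1, HasDerivAt t (f x)⁻¹ x
  tendsto_left : Tendsto t (𝓝[>] (-1)) atBot
  tendsto_right : Tendsto t (𝓝[<] 1) atTop

lemma tendsto_atBot_of_hasDerivAt_inv {f t : ℝ → ℝ} (hf : IsProfile f)
    (ht : ∀ x ∈ Ioo (-1 : ℝ) 1, HasDerivAt t (f x)⁻¹ x) : Tendsto t (𝓝[>] (-1)) atBot := by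
  have hslope := (hasDerivAt_iff_tendsto_slope.1 hf.deriv_neg_one).eventually
    (gt_mem_nhds (show (2 : ℝ) < 3 by norm_num))
  have hright : ∀ᶠ x in 𝓝[>] (-1 : ℝ), slope f (-1) x < 3 :=
    nhdsWithin_mono _ (fun x (hx : (-1 : ℝ) < x) => (ne_of_gt hx : x ≠ -1)) hslope
  obtain ⟨b, hb, hsub⟩ := (mem_nhdsGT_iff_exists_Ioo_subset' (show (-1 : ℝ) < 1 by norm_num)).1
    (hright.and (Ioo_mem_nhdsGT (show (-1 : ℝ) < 1 by norm_num)))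
  obtain ⟨d, hd, hdb⟩ := exists_between (mem_Ioi.1 hb)
  have hd1 : d < 1 := (hsub ⟨hd, hdb⟩).2.2
  have hderiv : ∀ x ∈ Ioc (-1) d, HasDerivAt (fun x => t x - 1 / 3 * Real.log (x + 1))
      ((f x)⁻¹ - 1 / 3 * (1 / (x + 1))) x := by
    intro x hx
    exact (ht x ⟨hx.1, hx.2.trans_lt hd1⟩).sub
      ((((hasDerivAt_id x).add_const 1).log
        (by simpa using (by linarith [hx.1] : x + 1 ≠ 0))).const_mul _)
  have hmono : MonotoneOn (fun x => t x - 1 / 3 * Real.log (x + 1)) (Ioc (-1) d) := by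
    refine monotoneOn_of_deriv_nonneg (convex_Ioc _ _)
      (fun x hx => (hderiv x hx).continuousAt.continuousWithinAt)
      (fun x hx => (hderiv x (interior_subset hx)).differentiableAt.differentiableWithinAt)
      fun x hx => ?_
    have hx' := interior_subset hx
    rw [(hderiv x hx').deriv]
    have hs : slope f (-1) x < 3 := (hsub ⟨hx'.1, hx'.2.trans_lt hdb⟩).1
    have hx1 : 0 < x + 1 := by linarith [hx'.1]
    rw [slope_def_field, hf.zero_neg_one, sub_neg_eq_add, div_lt_iff₀ hx1, sub_zero] at hs
    have h1 : (3 * (x + 1))⁻¹ ≤ (f x)⁻¹ :=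
      inv_anti₀ (hf.pos x ⟨hx'.1, hx'.2.trans_lt hd1⟩) hs.le
    have h2 : 1 / 3 * (1 / (x + 1)) = (3 * (x + 1))⁻¹ := by field_simp
    rw [h2]
    linarith
  have hlog : Tendsto (fun x : ℝ => 1 / 3 * Real.log (x + 1) + (t d - 1 / 3 * Real.log (d + 1)))
      (𝓝[>] (-1)) atBot := by
    refine tendsto_atBot_add_const_right _ _ (Tendsto.const_mul_atBot (by norm_num) ?_)
    refine Real.tendsto_log_nhdsGT_zero.comp (tendsto_nhdsWithin_iff.2 ⟨?_, ?_⟩)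
    · have : Tendsto (fun x : ℝ => x + 1) (𝓝 (-1)) (𝓝 (-1 + 1)) :=
        (continuous_id.add continuous_const).tendsto _
      simpa using this.mono_left nhdsWithin_le_nhds
    · filter_upwards [self_mem_nhdsWithin] with x hx
      simpa using (by linarith [mem_Ioi.1 hx] : 0 < x + 1)
  refine tendsto_atBot_mono' _ ?_ hlog
  filter_upwards [Ioo_mem_nhdsGT hd] with x hx
  have := hmono ⟨hx.1, hx.2.le⟩ (right_mem_Ioc.2 hd) hx.2.le
  simp only at this
  linarith

lemma IsProfile.comp_neg {f : ℝ → ℝ} (hf : IsProfile f) : IsProfile fun x => f (-x) where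
  contOn := hf.contOn.comp continuous_neg.continuousOn fun x hx =>
    ⟨by linarith [hx.2], by linarith [hx.1]⟩
  smoothOn := hf.smoothOn.comp contDiff_neg.contDiffOn fun x hx =>
    ⟨by linarith [hx.2], by linarith [hx.1]⟩
  pos x hx := hf.pos _ ⟨by linarith [hx.2], by linarith [hx.1]⟩
  zero_neg_one := by simpa using hf.zero_one
  zero_one := hf.zero_neg_one
  deriv_neg_one := by
    have h : HasDerivAt f (-2) (-(-1)) := by simpa using hf.deriv_one
    exact (h.comp (-1) (hasDerivAt_neg (-1))).congr_deriv (by norm_num)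
  deriv_one := (hf.deriv_neg_one.comp 1 (hasDerivAt_neg 1)).congr_deriv (by norm_num)

lemma IsProfile.exists_isConformalCoord {f : ℝ → ℝ} (hf : IsProfile f) :
    ∃ t, IsConformalCoord f t := by
  have hinv : ContinuousOn (fun x => (f x)⁻¹) (Ioo (-1) 1) :=
    (hf.contOn.mono Ioo_subset_Icc_self).inv₀ fun x hx => (hf.pos x hx).ne'
  have ht : ∀ x ∈ Ioo (-1 : ℝ) 1, HasDerivAt (fun x => ∫ y in (0 : ℝ)..x, (f y)⁻¹) (f x)⁻¹ x := by
    intro x hx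
    refine integral_hasDerivAt_right ?_ ?_ (hinv.continuousAt (isOpen_Ioo.mem_nhds hx))
    · refine (hinv.mono ?_).intervalIntegrable
      exact ordConnected_Ioo.uIcc_subset (by norm_num) hx
    · exact hinv.stronglyMeasurableAtFilter isOpen_Ioo x hx
  refine ⟨_, ht, tendsto_atBot_of_hasDerivAt_inv hf ht, ?_⟩
  set t := fun x => ∫ y in (0 : ℝ)..x, (f y)⁻¹
  have hneg : Tendsto (fun x => -t (-x)) (𝓝[>] (-1)) atBot := by
    refine tendsto_atBot_of_hasDerivAt_inv hf.comp_neg fun x hx => ?_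
    have h := (ht (-x) ⟨by linarith [hx.2], by linarith [hx.1]⟩).comp x (hasDerivAt_neg x)
    exact h.neg.congr_deriv (by simp)
  have h1 : Tendsto (fun x : ℝ => -x) (𝓝[<] 1) (𝓝[>] (-1)) := tendsto_neg_nhdsLT
  simpa [Function.comp_def] using tendsto_neg_atBot_atTop.comp (hneg.comp h1)

section IntegralOperator

variable {X : Type*} {K : X → X → ℝ} {C : ℝ}

lemma memLp_kernel [MeasurableSpace X] {ν : Measure X} [IsFiniteMeasure ν]
    (hmeas : Measurable (Function.uncurry K)) (hbdd : ∀ x y, |K x y| ≤ C) (x : X) :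
    MemLp (K x) 2 ν :=
  MemLp.of_bound (hmeas.comp measurable_prodMk_left).aestronglyMeasurable C
    (Eventually.of_forall fun y => hbdd x y)

lemma continuous_kernel_toLp [MetricSpace X] [MeasurableSpace X] {ν : Measure X}
    [IsFiniteMeasure ν] (hmeas : Measurable (Function.uncurry K))
    (hbdd : ∀ x y, |K x y| ≤ C) (hcont : ∀ᵐ y ∂ν, Continuous fun x => K x y) :
    Continuous fun x => (memLp_kernel (ν := ν) hmeas hbdd x).toLp (K x) := by
  refine continuous_iff_continuousAt.2 fun x => ?_
  rw [ContinuousAt, tendsto_iff_norm_sub_tendsto_zero]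
  have hsq : ∀ z, ‖(memLp_kernel (ν := ν) hmeas hbdd z).toLp (K z) -
      (memLp_kernel (ν := ν) hmeas hbdd x).toLp (K x)‖ =
      √(∫ y, (K z y - K x y) ^ 2 ∂ν) := by
    intro z
    rw [eq_comm, Real.sqrt_eq_iff_mul_self_eq (integral_nonneg fun _ => sq_nonneg _)
      (norm_nonneg _), ← MemLp.toLp_sub, ← real_inner_self_eq_norm_mul_norm, L2.inner_def]
    refine integral_congr_ae ?_
    filter_upwards [((memLp_kernel (ν := ν) hmeas hbdd z).sub
      (memLp_kernel hmeas hbdd x)).coeFn_toLp] with y hy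
    rw [hy]
    simp [sq]
  simp_rw [hsq]
  have h0 : (0 : ℝ) = √(∫ y, (K x y - K x y) ^ 2 ∂ν) := by simp
  rw [h0]
  refine (Real.continuous_sqrt.tendsto _).comp ?_
  refine tendsto_integral_filter_of_dominated_convergence (fun _ => (2 * C) ^ 2)
    (Eventually.of_forall fun z => ?_) (Eventually.of_forall fun z => ?_)
    (integrable_const _) ?_
  · exact (((hmeas.comp measurable_prodMk_left).sub
      (hmeas.comp measurable_prodMk_left)).pow_const 2).aestronglyMeasurable
  · refine Eventually.of_forall fun y => ?_
    rw [norm_pow]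
    refine pow_le_pow_left₀ (norm_nonneg _) ?_ 2
    refine (norm_sub_le _ _).trans ?_
    rw [two_mul]
    exact add_le_add (hbdd z y) (hbdd x y)
  · filter_upwards [hcont] with y hy
    exact ((hy.tendsto x).sub_const _).pow 2

/-- For a continuous family `g` in a Hilbert space indexed by a compact space, the operator
sending `u` to the continuous function `x ↦ ⟪g x, u⟫` is compact. -/
lemma exists_compact_toBoundedContinuous [MetricSpace X] [CompactSpace X] {H : Type*}
    [NormedAddCommGroup H] [InnerProductSpace ℝ H] {g : X → H} (hg : Continuous g) :
    ∃ S : H →L[ℝ] BoundedContinuousFunction X ℝ,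
      IsCompactOperator S ∧ ∀ u x, S u x = inner ℝ (g x) u := by
  obtain ⟨B, hB⟩ := (isCompact_range hg).isBounded.exists_norm_le
  have hB' : ∀ x, ‖g x‖ ≤ B := fun x => hB _ (mem_range_self x)
  have hbound : ∀ u x, ‖inner ℝ (g x) u‖ ≤ max B 0 * ‖u‖ := fun u x =>
    (norm_inner_le_norm _ _).trans
      (mul_le_mul_of_nonneg_right ((hB' x).trans (le_max_left _ _)) (norm_nonneg _))
  let S₀ : H →ₗ[ℝ] BoundedContinuousFunction X ℝ :=
    { toFun u := BoundedContinuousFunction.mkOfCompact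
        ⟨fun x => inner ℝ (g x) u, hg.inner continuous_const⟩
      map_add' u v := by
        ext x
        simp [inner_add_right]
      map_smul' c u := by
        ext x
        simp [inner_smul_right] }
  have hS₀ : ∀ u x, S₀ u x = inner ℝ (g x) u := fun u x => rfl
  let S := S₀.mkContinuous (max B 0) fun u => by
    refine (BoundedContinuousFunction.norm_le (by positivity)).2 fun x => ?_
    rw [hS₀]
    exact hbound u x
  refine ⟨S, ?_, hS₀⟩
  refine (isCompactOperator_iff_isCompact_closure_image_closedBall S.toLinearMap
    zero_lt_one).2 ?_
  refine BoundedContinuousFunction.arzela_ascoli (Metric.closedBall 0 (max B 0))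
    (isCompact_closedBall _ _) _ ?_ ?_
  · rintro _ x ⟨u, hu, rfl⟩
    rw [mem_closedBall_zero_iff] at hu ⊢
    exact (hbound u x).trans (mul_le_of_le_one_right (le_max_right _ _) hu)
  · intro x
    rw [Metric.equicontinuousAt_iff]
    intro ε hε
    obtain ⟨δ, hδ, h⟩ := Metric.continuousAt_iff.1 hg.continuousAt ε hε
    refine ⟨δ, hδ, fun y hy => ?_⟩
    rintro ⟨_, u, hu, rfl⟩
    rw [mem_closedBall_zero_iff] at hu
    change dist (inner ℝ (g x) u) (inner ℝ (g y) u) < ε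
    rw [dist_comm, dist_eq_norm, ← inner_sub_left]
    refine (norm_inner_le_norm _ _).trans_lt ?_
    refine (mul_le_of_le_one_right (norm_nonneg _) hu).trans_lt ?_
    rw [← dist_eq_norm]
    exact h hy

/-- A compact symmetric operator of norm more than `r > 0` has an eigenvalue of modulus more
than `r`. -/
lemma exists_hasEigenvalue_of_lt_norm {H : Type*} [NormedAddCommGroup H] [InnerProductSpace ℝ H]
    [CompleteSpace H] {T : H →L[ℝ] H} (hT : IsCompactOperator T) (hsymm : T.IsSymmetric)
    {r : ℝ} (hr : 0 < r) (h : r < ‖T‖) :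
    ∃ c, r < |c| ∧ Module.End.HasEigenvalue (T : Module.End ℝ H) c := by
  have hrad := T.spectralRadius_eq_nnnorm hsymm.isSelfAdjoint
  have hlt : ENNReal.ofReal r < spectralRadius ℝ T := by
    rw [hrad, ← enorm_eq_nnnorm, ← ofReal_norm]
    exact (ENNReal.ofReal_lt_ofReal_iff_of_nonneg hr.le).2 h
  obtain ⟨c, hc⟩ := lt_iSup_iff.1 hlt
  obtain ⟨hmem, hc⟩ := lt_iSup_iff.1 hc
  have hrc : r < |c| := by
    rw [← enorm_eq_nnnorm, ← ofReal_norm,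
      ENNReal.ofReal_lt_ofReal_iff_of_nonneg hr.le] at hc
    exact hc
  refine ⟨c, hrc, (hT.hasEigenvalue_iff_mem_spectrum ?_).2 hmem⟩
  exact abs_pos.1 (hr.trans hrc)

/-- If a symmetric kernel satisfies `R h ≤ ∫ K h` for a nonzero `h ≥ 0`, its integral operator has
a continuous eigenfunction with eigenvalue of modulus more than any given positive `r < R`. -/
lemma exists_eigenfunction_of_kernel [MetricSpace X] [CompactSpace X] [MeasurableSpace X]
    [BorelSpace X] {ν : Measure X} [IsFiniteMeasure ν] (hmeas : Measurable (Function.uncurry K))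
    (hbdd : ∀ x y, |K x y| ≤ C) (hcont : ∀ᵐ y ∂ν, Continuous fun x => K x y)
    (hsymm : ∀ x y, K x y = K y x) {h : X → ℝ} (hh : Continuous h) (hpos : ∀ x, 0 ≤ h x)
    (hne : h ≠ 0) {r R : ℝ} (hr : 0 < r) (hrR : r < R)
    (hK : ∀ x, R * h x ≤ ∫ y, K x y * h y ∂ν) :
    ∃ v : X → ℝ, Continuous v ∧ v ≠ 0 ∧ ∃ c, r < |c| ∧ ∀ x, ∫ y, K x y * v y ∂ν = c * v x := by
  have hg := continuous_kernel_toLp hmeas hbdd hcont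
  obtain ⟨S, hScomp, hS⟩ := exists_compact_toBoundedContinuous hg
  have hSint : ∀ (u : Lp ℝ 2 ν) x, S u x = ∫ y, K x y * u y ∂ν := by
    intro u x
    rw [hS, L2.inner_def]
    refine integral_congr_ae ?_
    filter_upwards [(memLp_kernel (ν := ν) hmeas hbdd x).coeFn_toLp] with y hy
    rw [hy]
    simp [mul_comm]
  let ι : BoundedContinuousFunction X ℝ →L[ℝ] Lp ℝ 2 ν := BoundedContinuousFunction.toLp 2 ν ℝ
  let T : Lp ℝ 2 ν →L[ℝ] Lp ℝ 2 ν := ι.comp S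
  have hTcomp : IsCompactOperator T := hScomp.clm_comp ι
  have hTae : ∀ u : Lp ℝ 2 ν, T u =ᵐ[ν] fun x => ∫ y, K x y * u y ∂ν := by
    intro u
    filter_upwards [BoundedContinuousFunction.coeFn_toLp (p := 2) ν ℝ (S u)] with x hx
    rw [← hSint]
    exact hx
  have hinner : ∀ u w : Lp ℝ 2 ν, inner ℝ (T u) w = ∫ x, ∫ y, K x y * u y * w x ∂ν ∂ν := by
    intro u w
    rw [L2.inner_def]
    refine integral_congr_ae ?_
    filter_upwards [hTae u] with x hx
    rw [hx, MeasureTheory.integral_mul_const]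
    simp [mul_comm]
  have hTsymm : T.IsSymmetric := by
    intro u w
    change inner ℝ (T u) w = inner ℝ u (T w)
    rw [real_inner_comm (T w) u, hinner, hinner, integral_integral_swap]
    · simp_rw [hsymm, mul_right_comm]
    · have hu : Integrable u ν := (Lp.memLp u).integrable (by norm_num)
      have hw : Integrable w ν := (Lp.memLp w).integrable (by norm_num)
      have := (hw.mul_prod hu).bdd_mul (c := C) hmeas.aestronglyMeasurable
        (Eventually.of_forall fun p => hbdd p.1 p.2)
      refine this.congr (Eventually.of_forall fun p => ?_)
      simp only [Function.uncurry]
      ring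
  have hhLp : MemLp h 2 ν :=
    (BoundedContinuousFunction.memLp_top
      (BoundedContinuousFunction.mkOfCompact ⟨h, hh⟩)).mono_exponent le_top
  let h' : Lp ℝ 2 ν := hhLp.toLp h
  have hh'ne : h' ≠ 0 := by
    intro h0
    have hae : h =ᵐ[ν] 0 := by
      have := hhLp.coeFn_toLp
      rw [show hhLp.toLp h = 0 from h0] at this
      exact this.symm.trans (Lp.coeFn_zero _ _ _)
    refine hne (funext fun x => le_antisymm ?_ (hpos x))
    have hzero : ∫ y, K x y * h y ∂ν = 0 := by
      refine integral_eq_zero_of_ae ?_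
      filter_upwards [hae] with y hy
      simp [hy]
    exact nonpos_of_mul_nonpos_right ((hK x).trans hzero.le) (hr.trans hrR)
  have hnorm : R * ‖h'‖ ≤ ‖T h'‖ := by
    have hR : 0 ≤ R := (hr.trans hrR).le
    have : ‖R • h'‖ ≤ ‖T h'‖ := by
      refine Lp.norm_le_norm_of_ae_le ?_
      filter_upwards [Lp.coeFn_smul R h', hTae h', hhLp.coeFn_toLp] with x h1 h2 h3
      have h4 : ∫ y, K x y * h' y ∂ν = ∫ y, K x y * h y ∂ν := by
        refine integral_congr_ae ?_
        filter_upwards [hhLp.coeFn_toLp] with y hy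
        rw [show h' y = h y from hy]
      rw [h1, h2, h4, Pi.smul_apply, show h' x = h x from h3, smul_eq_mul, Real.norm_of_nonneg
        (mul_nonneg hR (hpos x))]
      exact (hK x).trans (le_abs_self _)
    rwa [norm_smul, Real.norm_of_nonneg hR] at this
  have hTnorm : r < ‖T‖ := by
    refine hrR.trans_le ?_
    exact le_of_mul_le_mul_right (hnorm.trans (T.le_opNorm h')) (norm_pos_iff.2 hh'ne)
  obtain ⟨c, hrc, hc⟩ := exists_hasEigenvalue_of_lt_norm hTcomp hTsymm hr hTnorm
  obtain ⟨u, hu⟩ := hc.exists_hasEigenvector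
  have hc0 : c ≠ 0 := abs_pos.1 (hr.trans hrc)
  have hTu : T u = c • u := hu.apply_eq_smul
  have huv : u =ᵐ[ν] fun x => c⁻¹ * S u x := by
    filter_upwards [hTae u, Lp.coeFn_smul c u] with x h1 h2
    rw [hSint, ← h1, hTu, h2]
    simp [hc0]
  refine ⟨fun x => c⁻¹ * S u x, continuous_const.mul (S u).continuous, fun h0 => ?_, c, hrc,
    fun x => ?_⟩
  · refine hu.2 ((Lp.eq_zero_iff_ae_eq_zero).2 ?_)
    exact huv.trans (Eventually.of_forall fun x => congrFun h0 x)
  · rw [mul_inv_cancel_left₀ hc0, hSint]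
    refine integral_congr_ae ?_
    filter_upwards [huv] with y hy
    rw [hy]

end IntegralOperator

/-- The kernel `exp (-m |t x - t y|)` on `(-1, 1)²`, extended by zero. It is `2 m` times the
Green function of `-(d/dx)(f d/dx) + m² / f` when `t` is a conformal coordinate. -/
noncomputable def cylKernel (t : ℝ → ℝ) (m x y : ℝ) : ℝ :=
  (Ioo (-1 : ℝ) 1 ×ˢ Ioo (-1 : ℝ) 1).indicator
    (fun q => Real.exp (-(m * |t q.1 - t q.2|))) (x, y)

section CylKernel

variable {f t : ℝ → ℝ} {m : ℝ}

lemma cylKernel_of_mem {x y : ℝ} (hx : x ∈ Ioo (-1 : ℝ) 1) (hy : y ∈ Ioo (-1 : ℝ) 1) :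
    cylKernel t m x y = Real.exp (-(m * |t x - t y|)) :=
  indicator_of_mem (show (x, y) ∈ Ioo (-1 : ℝ) 1 ×ˢ Ioo (-1 : ℝ) 1 from ⟨hx, hy⟩) _

lemma cylKernel_of_left_notMem {x y : ℝ} (hx : x ∉ Ioo (-1 : ℝ) 1) : cylKernel t m x y = 0 :=
  indicator_of_notMem (fun h => hx h.1) _

lemma cylKernel_comm (x y : ℝ) : cylKernel t m x y = cylKernel t m y x := by
  simp only [cylKernel, indicator, mem_prod, and_comm, abs_sub_comm]

lemma cylKernel_nonneg (x y : ℝ) : 0 ≤ cylKernel t m x y :=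
  indicator_nonneg (fun _ _ => (Real.exp_pos _).le) _

lemma abs_cylKernel_le (hm : 0 ≤ m) (x y : ℝ) : |cylKernel t m x y| ≤ 1 := by
  rw [abs_of_nonneg (cylKernel_nonneg x y)]
  rw [cylKernel, indicator]
  split_ifs
  · exact Real.exp_le_one_iff.2 (neg_nonpos.2 (by positivity))
  · exact zero_le_one

lemma cylKernel_anti {m n : ℝ} (hmn : m ≤ n) (x y : ℝ) :
    cylKernel t n x y ≤ cylKernel t m x y := by
  refine indicator_le_indicator ?_
  gcongr

lemma IsConformalCoord.continuousOn (ht : IsConformalCoord f t) :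
    ContinuousOn t (Ioo (-1) 1) :=
  fun x hx => (ht.hasDerivAt x hx).continuousAt.continuousWithinAt

lemma IsConformalCoord.monotoneOn (hf : IsProfile f) (ht : IsConformalCoord f t) :
    MonotoneOn t (Ioo (-1) 1) := by
  refine monotoneOn_of_deriv_nonneg (convex_Ioo _ _) ht.continuousOn ?_ fun x hx => ?_
  · exact fun x hx =>
      (ht.hasDerivAt x (interior_subset hx)).differentiableAt.differentiableWithinAt
  · rw [(ht.hasDerivAt x (interior_subset hx)).deriv]
    exact (inv_pos.2 (hf.pos x (interior_subset hx))).le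

lemma measurable_cylKernel (ht : ContinuousOn t (Ioo (-1) 1)) :
    Measurable (Function.uncurry (cylKernel t m)) := by
  classical
  have hc : ContinuousOn (fun q : ℝ × ℝ => Real.exp (-(m * |t q.1 - t q.2|)))
      (Ioo (-1 : ℝ) 1 ×ˢ Ioo (-1 : ℝ) 1) := by
    have h1 : ContinuousOn (fun q : ℝ × ℝ => t q.1) (Ioo (-1 : ℝ) 1 ×ˢ Ioo (-1 : ℝ) 1) :=
      ht.comp continuousOn_fst fun q hq => hq.1
    have h2 : ContinuousOn (fun q : ℝ × ℝ => t q.2) (Ioo (-1 : ℝ) 1 ×ˢ Ioo (-1 : ℝ) 1) :=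
      ht.comp continuousOn_snd fun q hq => hq.2
    exact Real.continuous_exp.comp_continuousOn
      (continuousOn_const.mul (h1.sub h2).abs).neg
  have := hc.measurable_piecewise (g := 0) continuousOn_const
    (measurableSet_Ioo.prod measurableSet_Ioo)
  rw [piecewise_eq_indicator] at this
  exact this

lemma continuousOn_cylKernel (ht : IsConformalCoord f t) (hm : 0 < m) (y : ℝ) :
    ContinuousOn (fun x => cylKernel t m x y) (Icc (-1) 1) := by
  by_cases hy : y ∈ Ioo (-1 : ℝ) 1
  swap
  · refine (continuousOn_const (c := (0 : ℝ))).congr fun x _ => ?_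
    rw [cylKernel_comm]
    exact cylKernel_of_left_notMem hy
  have hlim : ∀ {l : Filter ℝ}, (∀ᶠ x in l, x ∈ Ioo (-1 : ℝ) 1) →
      Tendsto (fun x => |t x - t y|) l atTop → Tendsto (fun x => cylKernel t m x y) l (𝓝 0) := by
    intro l hl habs
    have := Real.tendsto_exp_neg_atTop_nhds_zero.comp (habs.const_mul_atTop hm)
    refine this.congr' ?_
    filter_upwards [hl] with x hx
    rw [cylKernel_of_mem hx hy]
    rfl
  have hle : (-1 : ℝ) < 1 := by norm_num
  intro x hx
  rcases eq_or_lt_of_le hx.1 with rfl | hx1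
  · have : ContinuousWithinAt (fun x => cylKernel t m x y) (Ioi (-1)) (-1) := by
      rw [ContinuousWithinAt, cylKernel_of_left_notMem (by simp)]
      exact hlim (Ioo_mem_nhdsGT hle) (tendsto_abs_atBot_atTop.comp
        (tendsto_atBot_add_const_right _ (-t y) ht.tendsto_left))
    exact (continuousWithinAt_Ioi_iff_Ici.1 this).mono Icc_subset_Ici_self
  rcases eq_or_lt_of_le hx.2 with rfl | hx2
  · have : ContinuousWithinAt (fun x => cylKernel t m x y) (Iio 1) 1 := by
      rw [ContinuousWithinAt, cylKernel_of_left_notMem (by simp)]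
      exact hlim (Ioo_mem_nhdsLT hle) (tendsto_abs_atTop_atTop.comp
        (tendsto_atTop_add_const_right _ (-t y) ht.tendsto_right))
    exact (continuousWithinAt_Iio_iff_Iic.1 this).mono Icc_subset_Iic_self
  · refine ContinuousAt.continuousWithinAt ?_
    have hc : ContinuousAt (fun z => Real.exp (-(m * |t z - t y|))) x := by
      have := (ht.hasDerivAt x ⟨hx1, hx2⟩).continuousAt
      fun_prop
    refine hc.congr ?_
    filter_upwards [isOpen_Ioo.mem_nhds (⟨hx1, hx2⟩ : x ∈ Ioo (-1 : ℝ) 1)] with z hz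
    exact (cylKernel_of_mem hz hy).symm

lemma intervalIntegrable_cylKernel_mul (ht : IsConformalCoord f t) (hm : 0 ≤ m) {h : ℝ → ℝ}
    (hh : ContinuousOn h (Icc (-1) 1)) (x : ℝ) :
    IntervalIntegrable (fun y => cylKernel t m x y * h y) volume (-1) 1 := by
  have hInt : IntervalIntegrable h volume (-1) 1 :=
    ContinuousOn.intervalIntegrable (by rwa [uIcc_of_le (by norm_num)])
  rw [intervalIntegrable_iff] at hInt ⊢
  exact hInt.bdd_mul (c := 1)
    ((measurable_cylKernel ht.continuousOn).comp measurable_prodMk_left).aestronglyMeasurable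
    (Eventually.of_forall fun y => abs_cylKernel_le hm x y)

/-- `z = ∫ G(·, y) h(y) dy` solves `-(f z')' + (m² / f) z = h` with zero boundary values. -/
lemma green_system (hf : IsProfile f) (ht : IsConformalCoord f t) (hm : 0 < m) {h : ℝ → ℝ}
    (hh : ContinuousOn h (Icc (-1) 1)) :
    ∃ p : ℝ → ℝ,
      (∀ x ∈ Ioo (-1 : ℝ) 1, HasDerivAt
        (fun x => (2 * m)⁻¹ * ∫ y in (-1 : ℝ)..1, cylKernel t m x y * h y) (p x / f x) x) ∧
      ∀ x ∈ Ioo (-1 : ℝ) 1, HasDerivAt p (m ^ 2 / f x *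
        ((2 * m)⁻¹ * ∫ y in (-1 : ℝ)..1, cylKernel t m x y * h y) - h x) x := by
  set E : ℝ → ℝ := fun x => Real.exp (m * t x) with hE
  have hEpos : ∀ x, 0 < E x := fun x => Real.exp_pos _
  have hEderiv : ∀ x ∈ Ioo (-1 : ℝ) 1, HasDerivAt E (E x * (m * (f x)⁻¹)) x := fun x hx =>
    ((ht.hasDerivAt x hx).const_mul m).exp
  have hEcont : ContinuousOn E (Ioo (-1) 1) := fun x hx =>
    (hEderiv x hx).continuousAt.continuousWithinAt
  have hh' : ContinuousOn h (Ioo (-1) 1) := hh.mono Ioo_subset_Icc_self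
  have hKint := intervalIntegrable_cylKernel_mul ht hm.le hh
  have hKleft : ∀ x ∈ Ioo (-1 : ℝ) 1, ∀ y ∈ Ioc (-1) x, cylKernel t m x y = E y / E x := by
    intro x hx y hy
    have hy' : y ∈ Ioo (-1 : ℝ) 1 := ⟨hy.1, hy.2.trans_lt hx.2⟩
    rw [cylKernel_of_mem hx hy', abs_of_nonneg (sub_nonneg.2 (ht.monotoneOn hf hy' hx hy.2)),
      hE, ← Real.exp_sub]
    ring_nf
  have hKright : ∀ x ∈ Ioo (-1 : ℝ) 1, ∀ y ∈ Ioo x 1, cylKernel t m x y = E x / E y := by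
    intro x hx y hy
    have hy' : y ∈ Ioo (-1 : ℝ) 1 := ⟨hx.1.trans hy.1, hy.2⟩
    rw [cylKernel_comm, hKleft y hy' x ⟨hx.1, hy.1.le⟩]
  have hsubl : ∀ x ∈ Ioo (-1 : ℝ) 1, uIcc (-1) x ⊆ uIcc (-1 : ℝ) 1 := fun x hx =>
    uIcc_subset_uIcc_left (by rw [uIcc_of_le (by norm_num)]; exact Ioo_subset_Icc_self hx)
  have hsubr : ∀ x ∈ Ioo (-1 : ℝ) 1, uIcc x 1 ⊆ uIcc (-1 : ℝ) 1 := fun x hx =>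
    uIcc_subset_uIcc_right (by rw [uIcc_of_le (by norm_num)]; exact Ioo_subset_Icc_self hx)
  have hne1 : ∀ᵐ y : ℝ, y ≠ 1 := Measure.ae_ne volume 1
  have hAeq : ∀ x ∈ Ioo (-1 : ℝ) 1, ∀ y ∈ Ioc (-1) x,
      E y * h y = E x * (cylKernel t m x y * h y) := by
    intro x hx y hy
    have := (hEpos x).ne'
    rw [hKleft x hx y hy]
    field_simp
  have hBeq : ∀ x ∈ Ioo (-1 : ℝ) 1, ∀ y ∈ Ioo x 1,
      (E y)⁻¹ * h y = (E x)⁻¹ * (cylKernel t m x y * h y) := by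
    intro x hx y hy
    have := (hEpos x).ne'
    rw [hKright x hx y hy]
    field_simp
  have hAint : ∀ x ∈ Ioo (-1 : ℝ) 1, IntervalIntegrable (fun y => E y * h y) volume (-1) x := by
    intro x hx
    refine (((hKint x).mono_set (hsubl x hx)).const_mul (E x)).congr ?_
    rw [uIoc_of_le hx.1.le]
    exact fun y hy => (hAeq x hx y hy).symm
  have hBint : ∀ x ∈ Ioo (-1 : ℝ) 1,
      IntervalIntegrable (fun y => (E y)⁻¹ * h y) volume x 1 := by
    intro x hx
    refine (((hKint x).mono_set (hsubr x hx)).const_mul (E x)⁻¹).congr_ae ?_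
    rw [uIoc_of_le hx.2.le]
    filter_upwards [ae_restrict_mem measurableSet_Ioc, ae_restrict_of_ae hne1] with y hy hy1
    exact (hBeq x hx y ⟨hy.1, lt_of_le_of_ne hy.2 hy1⟩).symm
  set A : ℝ → ℝ := fun x => ∫ y in (-1 : ℝ)..x, E y * h y
  set B : ℝ → ℝ := fun x => ∫ y in x..1, (E y)⁻¹ * h y
  have hAc : ContinuousOn (fun y => E y * h y) (Ioo (-1) 1) := hEcont.mul hh'
  have hBc : ContinuousOn (fun y => (E y)⁻¹ * h y) (Ioo (-1) 1) :=
    (hEcont.inv₀ fun x _ => (hEpos x).ne').mul hh'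
  have hA : ∀ x ∈ Ioo (-1 : ℝ) 1, HasDerivAt A (E x * h x) x := fun x hx =>
    integral_hasDerivAt_right (hAint x hx) (hAc.stronglyMeasurableAtFilter isOpen_Ioo x hx)
      (hAc.continuousAt (isOpen_Ioo.mem_nhds hx))
  have hB : ∀ x ∈ Ioo (-1 : ℝ) 1, HasDerivAt B (-((E x)⁻¹ * h x)) x := fun x hx =>
    integral_hasDerivAt_left (hBint x hx) (hBc.stronglyMeasurableAtFilter isOpen_Ioo x hx)
      (hBc.continuousAt (isOpen_Ioo.mem_nhds hx))
  have hz : ∀ x ∈ Ioo (-1 : ℝ) 1,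
      ∫ y in (-1 : ℝ)..1, cylKernel t m x y * h y = (E x)⁻¹ * A x + E x * B x := by
    intro x hx
    have hE0 := (hEpos x).ne'
    rw [← integral_add_adjacent_intervals ((hKint x).mono_set (hsubl x hx))
      ((hKint x).mono_set (hsubr x hx))]
    congr 1
    · rw [← intervalIntegral.integral_const_mul]
      refine intervalIntegral.integral_congr_ae (Eventually.of_forall fun y hy => ?_)
      rw [uIoc_of_le hx.1.le] at hy
      rw [hAeq x hx y hy, inv_mul_cancel_left₀ hE0]
    · rw [← intervalIntegral.integral_const_mul]
      refine intervalIntegral.integral_congr_ae ?_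
      filter_upwards [hne1] with y hy1 hy
      rw [uIoc_of_le hx.2.le] at hy
      rw [hBeq x hx y ⟨hy.1, lt_of_le_of_ne hy.2 hy1⟩, mul_inv_cancel_left₀ hE0]
  refine ⟨fun x => 2⁻¹ * (E x * B x - (E x)⁻¹ * A x), fun x hx => ?_, fun x hx => ?_⟩
  · have hd := ((((hEderiv x hx).inv (hEpos x).ne').mul (hA x hx)).add
      ((hEderiv x hx).mul (hB x hx))).const_mul (2 * m)⁻¹
    refine (hd.congr_of_eventuallyEq ?_).congr_deriv ?_
    · filter_upwards [isOpen_Ioo.mem_nhds hx] with y hy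
      rw [hz y hy]
      rfl
    · have h1 := (hEpos x).ne'
      have h2 := (hf.pos x hx).ne'
      simp only [Pi.inv_apply]
      field_simp
      ring
  · have hd := (((hEderiv x hx).mul (hB x hx)).sub
      (((hEderiv x hx).inv (hEpos x).ne').mul (hA x hx))).const_mul (2 : ℝ)⁻¹
    refine hd.congr_deriv ?_
    rw [hz x hx]
    have h1 := (hEpos x).ne'
    have h2 := (hf.pos x hx).ne'
    simp only [Pi.inv_apply]
    field_simp
    ring

lemma green_continuousOn (ht : IsConformalCoord f t) (hm : 0 < m) {h : ℝ → ℝ}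
    (hh : ContinuousOn h (Icc (-1) 1)) :
    ContinuousOn (fun x => ∫ y in (-1 : ℝ)..1, cylKernel t m x y * h y) (Icc (-1) 1) := by
  have hInt : IntervalIntegrable h volume (-1) 1 :=
    ContinuousOn.intervalIntegrable (by rwa [uIcc_of_le (by norm_num)])
  intro x hx
  refine intervalIntegral.continuousWithinAt_of_dominated_interval (bound := fun y => ‖h y‖)
    (Eventually.of_forall fun z => ?_) (Eventually.of_forall fun z => ?_) hInt.norm ?_
  · exact (intervalIntegrable_iff.1
      (intervalIntegrable_cylKernel_mul ht hm.le hh z)).aestronglyMeasurable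
  · refine Eventually.of_forall fun y _ => ?_
    rw [norm_mul]
    exact mul_le_of_le_one_left (norm_nonneg _) (abs_cylKernel_le hm.le z y)
  · exact Eventually.of_forall fun y _ =>
      (continuousOn_cylKernel ht hm y x hx).mul continuousWithinAt_const

end CylKernel

lemma integral_subtype_Icc_eq_intervalIntegral (g : ℝ → ℝ) :
    ∫ y : Icc (-1 : ℝ) 1, g y ∂(Measure.comap Subtype.val volume) =
      ∫ y in (-1 : ℝ)..1, g y := by
  rw [integral_subtype_comap measurableSet_Icc g, integral_Icc_eq_integral_Ioc,
    intervalIntegral.integral_of_le (by norm_num)]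

/-- A solution of the eigenvalue system is reproduced by the Green operator. -/
lemma eq_green_of_system {f t : ℝ → ℝ} (hf : IsProfile f) (ht : IsConformalCoord f t)
    {m lam : ℝ} (hm : 0 < m) {u p : ℝ → ℝ} (hc : ContinuousOn u (Icc (-1) 1))
    (hl : u (-1) = 0) (hr : u 1 = 0)
    (hu : ∀ x ∈ Ioo (-1 : ℝ) 1, HasDerivAt u (p x / f x) x)
    (hp : ∀ x ∈ Ioo (-1 : ℝ) 1, HasDerivAt p ((m ^ 2 / f x - lam) * u x) x) :
    ∀ x ∈ Icc (-1 : ℝ) 1,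
      2 * m * u x = lam * ∫ y in (-1 : ℝ)..1, cylKernel t m x y * u y := by
  obtain ⟨q, hz, hq⟩ := green_system hf ht hm hc
  have hzc := green_continuousOn ht hm hc
  intro x hx
  have := eq_zero_of_system (f := f) (c := fun x => m ^ 2 / f x)
    (w := fun x => u x - lam * ((2 * m)⁻¹ * ∫ y in (-1 : ℝ)..1, cylKernel t m x y * u y))
    (p := fun x => p x - lam * q x) hf.pos
    (hc.sub (continuousOn_const.mul (continuousOn_const.mul hzc)))
    (by simp [hl, cylKernel_of_left_notMem]) (by simp [hr, cylKernel_of_left_notMem])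
    (fun y hy => ((hu y hy).sub ((hz y hy).const_mul lam)).congr_deriv (by ring))
    (fun y hy => ((hp y hy).sub ((hq y hy).const_mul lam)).congr_deriv (by ring))
    (fun y hy => div_pos (pow_pos hm 2) (hf.pos y hy)) x hx
  rw [sub_eq_zero] at this
  rw [this]
  field_simp

/-- A nonzero continuous eigenfunction of the kernel is an eigenfunction of `L_m`. -/
lemma inSpec_of_kernel_eigenfunction {f t : ℝ → ℝ} (hf : IsProfile f)
    (ht : IsConformalCoord f t) {m : ℕ} (hm : 1 ≤ m) {v : ℝ → ℝ} {c : ℝ} (hc : c ≠ 0)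
    (hv : ContinuousOn v (Icc (-1) 1)) (hne : ∃ x ∈ Icc (-1 : ℝ) 1, v x ≠ 0)
    (hK : ∀ x ∈ Icc (-1 : ℝ) 1,
      ∫ y in (-1 : ℝ)..1, cylKernel t m x y * v y = c * v x) :
    InSpec f m (2 * m / c) := by
  have hm0 : (0 : ℝ) < m := by exact_mod_cast hm
  have hzero : ∀ x ∈ Icc (-1 : ℝ) 1, x ∉ Ioo (-1 : ℝ) 1 → v x = 0 := by
    intro x hx hx'
    have := hK x hx
    simp only [cylKernel_of_left_notMem hx', zero_mul, intervalIntegral.integral_zero] at this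
    exact (mul_eq_zero.1 this.symm).resolve_left hc
  obtain ⟨p, hz, hp⟩ := green_system hf ht hm0 hv
  refine InSpec.of_system hf (p := fun x => 2 * m / c * p x) hv ?_
    (fun _ => ⟨hzero _ (by simp) (by simp), hzero _ (by simp) (by simp)⟩) (fun x hx => ?_)
    fun x hx => ?_
  · obtain ⟨x, hx, hvx⟩ := hne
    exact ⟨x, not_imp_comm.1 (hzero x hx) hvx, hvx⟩
  · refine (((hz x hx).const_mul (2 * m / c)).congr_of_eventuallyEq ?_).congr_deriv (by ring)
    filter_upwards [isOpen_Ioo.mem_nhds hx] with y hy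
    rw [hK y (Ioo_subset_Icc_self hy)]
    field_simp
  · refine ((hp x hx).const_mul (2 * m / c)).congr_deriv ?_
    rw [hK x (Ioo_subset_Icc_self hx)]
    have := (hf.pos x hx).ne'
    field_simp

/-- The bottom of the spectrum of `L_m` is strictly increasing in `m ≥ 1`. -/
lemma InSpec.exists_lt {f : ℝ → ℝ} (hf : IsProfile f) {m k : ℕ} (hm : 1 ≤ m) (hmk : m < k)
    {lam : ℝ} (h : InSpec f k lam) : ∃ lam', InSpec f m lam' ∧ lam' < lam := by
  have hk : 1 ≤ k := hm.trans hmk.le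
  have hm0 : (0 : ℝ) < m := by exact_mod_cast hm
  have hk0 : (0 : ℝ) < k := by exact_mod_cast hk
  have hmk' : (m : ℝ) < k := by exact_mod_cast hmk
  have hlam := h.pos hf hk
  obtain ⟨t, ht⟩ := hf.exists_isConformalCoord
  obtain ⟨u, p, huc, ⟨x₀, hx₀, hux₀⟩, hb, hu, hp⟩ := h.exists_system hf
  have hgreen := eq_green_of_system hf ht hk0 huc (hb hk).1 (hb hk).2 hu hp
  have hbound : ∀ x ∈ Icc (-1 : ℝ) 1,
      2 * k / lam * |u x| ≤ ∫ y in (-1 : ℝ)..1, cylKernel t m x y * |u y| := by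
    intro x hx
    have heq : 2 * k / lam * u x = ∫ y in (-1 : ℝ)..1, cylKernel t k x y * u y := by
      rw [div_mul_eq_mul_div, hgreen x hx, mul_div_cancel_left₀ _ hlam.ne']
    rw [← abs_of_pos (show 0 < 2 * k / lam by positivity), ← abs_mul, heq]
    refine (abs_integral_le_integral_abs (by norm_num)).trans ?_
    refine integral_mono_on (by norm_num) (intervalIntegrable_cylKernel_mul ht hk0.le huc x).abs
      (intervalIntegrable_cylKernel_mul ht hm0.le huc.abs x) fun y _ => ?_
    rw [abs_mul, abs_of_nonneg (cylKernel_nonneg x y)]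
    exact mul_le_mul_of_nonneg_right (cylKernel_anti hmk'.le x y) (abs_nonneg _)
  have hfin : IsFiniteMeasure (Measure.comap Subtype.val volume : Measure (Icc (-1 : ℝ) 1)) :=
    ⟨by rw [comap_subtype_coe_apply measurableSet_Icc, image_univ, Subtype.range_coe]; simp⟩
  obtain ⟨v, hv, hvne, c, hc, hvK⟩ := exists_eigenfunction_of_kernel
    (X := Icc (-1 : ℝ) 1) (K := fun x y => cylKernel t m x y) (C := 1)
    (ν := Measure.comap Subtype.val volume)
    (h := fun x => |u x|) (r := 2 * m / lam) (R := 2 * k / lam)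
    ((measurable_cylKernel ht.continuousOn).comp
      (measurable_subtype_coe.prodMap measurable_subtype_coe))
    (fun x y => abs_cylKernel_le hm0.le x y)
    (Eventually.of_forall fun y => (continuousOn_cylKernel ht hm0 y).domRestrict)
    (fun x y => cylKernel_comm _ _) huc.domRestrict.abs (fun x => abs_nonneg _)
    (fun h0 => hux₀ (abs_eq_zero.1 (congrFun h0 ⟨x₀, Ioo_subset_Icc_self hx₀⟩)))
    (by positivity) (by gcongr) fun x => by
      rw [integral_subtype_Icc_eq_intervalIntegral fun y => cylKernel t m x y * |u y|]
      exact hbound x x.2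
  have hle : (-1 : ℝ) ≤ 1 := by norm_num
  have hr : 0 < 2 * m / lam := by positivity
  have hc0 : c ≠ 0 := abs_pos.1 (hr.trans hc)
  have hext : ∀ x : Icc (-1 : ℝ) 1, IccExtend hle v x = v x := IccExtend_val hle v
  have hspec : InSpec f m (2 * m / c) := by
    refine inSpec_of_kernel_eigenfunction hf ht hm hc0 (v := IccExtend hle v)
      hv.Icc_extend'.continuousOn ?_ fun x hx => ?_
    · obtain ⟨x, hx⟩ := Function.ne_iff.1 hvne
      exact ⟨x, x.2, by rwa [hext]⟩
    · rw [← integral_subtype_Icc_eq_intervalIntegral, hext ⟨x, hx⟩, ← hvK ⟨x, hx⟩]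
      simp_rw [hext]
  have hcpos : 0 < c := (div_pos_iff_of_pos_left (by positivity)).1 (hspec.pos hf hm)
  refine ⟨_, hspec, ?_⟩
  rw [abs_of_pos hcpos] at hc
  exact (div_lt_comm₀ hlam hcpos).1 hc

/-- Every eigenvalue of `L_k` has at least `k` distinct Laplace eigenvalues below it. -/
lemma le_index_of_mem_spec {f : ℝ → ℝ} (hf : IsProfile f) {Λ : ℕ → ℝ} (hΛmono : StrictMono Λ)
    (hΛrange : range Λ = Eigs f) (k : ℕ) {n : ℕ} (h : InSpec f k (Λ n)) : k ≤ n := by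
  induction k generalizing n with
  | zero => exact n.zero_le
  | succ m ih =>
    obtain ⟨lam, hlam, hlt⟩ : ∃ lam, InSpec f m lam ∧ lam < Λ n := by
      rcases Nat.eq_zero_or_pos m with rfl | hm
      · exact ⟨0, inSpec_zero f, h.pos hf le_rfl⟩
      · exact h.exists_lt hf hm m.lt_succ_self
    obtain ⟨i, rfl⟩ : lam ∈ range Λ := hΛrange ▸ mem_iUnion.2 ⟨m, hlam⟩
    exact (ih hlam).trans_lt (hΛmono.lt_iff_lt.1 hlt)

/-- The `(k+j)`-th distinct Laplace eigenvalue is at most the `(j+1)`-st eigenvalue of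
`L_k`: `λ_{k+j} ≤ λ_k^{j+1}`. -/
theorem distinct_eigenvalue_le (f : ℝ → ℝ) (hf : IsProfile f)
    (Λ : ℕ → ℝ) (hΛmono : StrictMono Λ) (hΛrange : Set.range Λ = Eigs f)
    (k : ℕ) (hk : 1 ≤ k)
    (μ : ℕ → ℝ) (hμmono : StrictMono μ) (hμrange : Set.range μ = Spec f k) :
    ∀ j : ℕ, Λ (k + j) ≤ μ j := by
  have hμ : ∀ j, InSpec f k (μ j) := fun j => (hμrange ▸ mem_range_self j : μ j ∈ Spec f k)
  have hex : ∀ j, ∃ n, Λ n = μ j := fun j => by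
    have : μ j ∈ Eigs f := mem_iUnion.2 ⟨k, hμ j⟩
    rwa [← hΛrange] at this
  choose n hn using hex
  have hnmono : StrictMono n := fun i j hij =>
    hΛmono.lt_iff_lt.1 (by rw [hn, hn]; exact hμmono hij)
  intro j
  rw [← hn j]
  refine hΛmono.monotone ?_
  induction j with
  | zero => exact le_index_of_mem_spec hf hΛmono hΛrange k (by rw [hn]; exact hμ 0)
  | succ j ih => exact Nat.succ_le_of_lt (ih.trans_lt (hnmono j.lt_succ_self))
end
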